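/- arXiv:0712.1442 — 12 statements merged into one kernel-verified Lean document; each statement's English description precedes it below -/
import Mathlib

section
/- For every natural number n ≥ 1, the maximum cardinality of a set of permutations of [n] = {1,…,n} such that any two of them differ by at least 2 in some position equals n!/2^⌊n/2⌋; that is, T(n, D) = n!/2^⌊n/2⌋ where D = {2,3,4,…} is the complement of {1} in the positive integers. -/
/-- Two permutations of `[n]` are `G(D)`-different if at some position the
absolute difference of their values lies in `D`. `T n D` is the maximum
cardinality of a set of pairwise `G(D)`-different permutations of `[n]`. -/
noncomputable def T (n : ℕ) (D : Set ℕ) : ℕ :=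
  sSup {k | ∃ S : Finset (Equiv.Perm (Fin n)), S.card = k ∧
    ∀ π ∈ S, ∀ σ ∈ S, π ≠ σ →
      ∃ i : Fin n, ((π i : ℤ) - (σ i : ℤ)).natAbs ∈ D}

/-- The parity of the order pattern of `(a, b, c)`. -/
def patternParity (a b c : ℕ) : Bool :=
  (decide (a < b) ^^ decide (b < c)) ^^ decide (a < c)

theorem patternParity_swap_left_ne {a b c : ℕ} (hab : a ≠ b) :
    patternParity a b c ≠ patternParity b a c := by
  unfold patternParity
  rcases lt_or_gt_of_ne hab with h | h <;>
    by_cases h₁ : a < c <;> by_cases h₂ : b < c <;> simp [h, h.le, h₁, h₂]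

theorem patternParity_swap_right_ne {a b c : ℕ} (hbc : b ≠ c) :
    patternParity a b c ≠ patternParity a c b := by
  unfold patternParity
  rcases lt_or_gt_of_ne hbc with h | h <;>
    by_cases h₁ : a < c <;> by_cases h₂ : a < b <;> simp [h, h.le, h₁, h₂]

theorem apply_succ_of_apply_eq_succ {τ : Equiv.Perm ℕ}
    (hτ : ∀ v, τ v ≤ v + 1 ∧ v ≤ τ v + 1) (v : ℕ) (hv : τ v = v + 1) : τ (v + 1) = v := by
  induction v with
  | zero =>
    obtain ⟨w, hw⟩ := τ.surjective 0
    have hw' := hτ w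
    obtain rfl | rfl : w = 0 ∨ w = 1 := by omega
    · omega
    · exact hw
  | succ v ih =>
    obtain ⟨w, hw⟩ := τ.surjective (v + 1)
    have hw' := hτ w
    obtain rfl | rfl | rfl : w = v ∨ w = v + 1 ∨ w = v + 2 := by omega
    · have := ih hw
      omega
    · omega
    · exact hw

theorem apply_eq_succ_of_apply_succ {τ : Equiv.Perm ℕ}
    (hτ : ∀ v, τ v ≤ v + 1 ∧ v ≤ τ v + 1) (v : ℕ) (hv : τ (v + 1) = v) : τ v = v + 1 := by
  induction v with
  | zero =>
    have h := hτ 0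
    have : τ 0 ≠ τ (0 + 1) := τ.injective.ne (by simp)
    omega
  | succ v ih =>
    have h := hτ (v + 1)
    have h₁ : τ (v + 1) ≠ τ (v + 1 + 1) := τ.injective.ne (by simp)
    have h₂ : τ v ≠ τ (v + 1 + 1) := τ.injective.ne (by omega)
    by_cases h₃ : τ (v + 1) = v
    · have := ih h₃
      omega
    · omega

/-- Permutations of `ℕ` fixing every `v ≥ n` that are pointwise at distance at most one and have
the same patterns on all the triples `2k, 2k+1, 2k+2` with `k < n / 2` are equal. -/
theorem eq_of_patternParity_eq {n : ℕ} {f g : Equiv.Perm ℕ}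
    (hf : ∀ v, n ≤ v → f v = v) (hg : ∀ v, n ≤ v → g v = v)
    (hfg : ∀ i, f i ≤ g i + 1 ∧ g i ≤ f i + 1)
    (hc : ∀ k < n / 2,
      patternParity (f.symm (2 * k)) (f.symm (2 * k + 1)) (f.symm (2 * k + 2)) =
        patternParity (g.symm (2 * k)) (g.symm (2 * k + 1)) (g.symm (2 * k + 2))) :
    f = g := by
  obtain ⟨τ, hτdef⟩ : ∃ τ : Equiv.Perm ℕ, τ = f.symm.trans g := ⟨_, rfl⟩
  have hτv : ∀ v, τ v = g (f.symm v) := fun v => by rw [hτdef]; rfl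
  have hτ : ∀ v, τ v ≤ v + 1 ∧ v ≤ τ v + 1 := fun v => by
    have := hfg (f.symm v)
    rw [Equiv.apply_symm_apply] at this
    rw [hτv]
    omega
  have hfix : ∀ v, n ≤ v → τ v = v := fun v hv => by
    rw [hτv, f.symm_apply_eq.2 (hf v hv).symm, hg v hv]
  have hpos : ∀ v w, τ v = w → g.symm w = f.symm v := fun v w h => by
    rw [← h, hτv, Equiv.symm_apply_apply]
  have hodd : ∀ k, τ (2 * k + 1) ≠ 2 * k + 2 := by
    intro k
    induction k with
    | zero =>
      intro h
      have h' : τ 2 = 1 := apply_succ_of_apply_eq_succ hτ 1 h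
      have h₀ : τ 0 = 0 := by
        have := hτ 0
        have : τ 0 ≠ τ 2 := τ.injective.ne (by simp)
        omega
      have hn : 2 < n := by
        by_contra hn
        have := hfix 2 (by omega)
        omega
      have := hc 0 (by omega)
      simp only [Nat.mul_zero, Nat.zero_add] at this h
      rw [hpos _ _ h, hpos _ _ h', hpos _ _ h₀] at this
      exact patternParity_swap_right_ne (f.symm.injective.ne (by simp)) this
    | succ k ih =>
      intro h
      have h' := apply_succ_of_apply_eq_succ hτ _ h
      have h₀ : τ (2 * (k + 1)) = 2 * (k + 1) := by
        have h₁ := hτ (2 * (k + 1))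
        have h₂ : τ (2 * (k + 1)) ≠ τ (2 * (k + 1) + 1 + 1) := τ.injective.ne (by omega)
        have h₃ : τ (2 * k + 1 + 1) = 2 * k + 1 → _ := apply_eq_succ_of_apply_succ hτ (2 * k + 1)
        rw [show 2 * k + 1 + 1 = 2 * (k + 1) by ring] at h₃
        omega
      have hn : 2 * (k + 1) + 2 < n := by
        by_contra hn
        have := hfix (2 * (k + 1) + 1 + 1) (by omega)
        omega
      have := hc (k + 1) (by omega)
      rw [hpos _ _ h, hpos _ _ h', hpos _ _ h₀] at this
      exact patternParity_swap_right_ne (f.symm.injective.ne (by simp)) this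
  have heven : ∀ j k, n ≤ k + j → τ (2 * k) ≠ 2 * k + 1 := by
    intro j
    induction j with
    | zero =>
      intro k hk h
      have := hfix (2 * k) (by omega)
      omega
    | succ j ih =>
      intro k hk h
      have h' := apply_succ_of_apply_eq_succ hτ _ h
      have h₂ : τ (2 * k + 2) = 2 * k + 2 := by
        have h₁ := hτ (2 * k + 2)
        have h₂ : τ (2 * k + 2) ≠ τ (2 * k) := τ.injective.ne (by omega)
        have h₃ : τ (2 * k + 2) ≠ 2 * k + 2 + 1 := ih (k + 1) (by omega)
        omega
      have hn : 2 * k + 1 < n := by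
        by_contra hn
        have := hfix (2 * k + 1) (by omega)
        omega
      have := hc k (by omega)
      rw [hpos _ _ h, hpos _ _ h', hpos _ _ h₂] at this
      exact patternParity_swap_left_ne (f.symm.injective.ne (by simp)) this
  have hup : ∀ v, τ v ≠ v + 1 := fun v => by
    obtain ⟨k, rfl | rfl⟩ := v.even_or_odd'
    · exact heven n k (by omega)
    · exact hodd k
  have hid : ∀ v, τ v = v := fun v => by
    have h₁ := hτ v
    have h₂ := hup v
    cases v with
    | zero => omega
    | succ v =>
      have h₃ := hup v
      have h₄ := mt (apply_eq_succ_of_apply_succ hτ v) h₃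
      omega
  ext v
  have := hid (f v)
  rw [hτv, Equiv.symm_apply_apply] at this
  exact this.symm

/-- The extension of a permutation of `Fin n` by the identity to all of `ℕ`. -/
def permNat {n : ℕ} (π : Equiv.Perm (Fin n)) : Equiv.Perm ℕ :=
  π.extendDomain Fin.equivSubtype

theorem permNat_val {n : ℕ} (π : Equiv.Perm (Fin n)) (i : Fin n) : permNat π i = π i :=
  π.extendDomain_apply_image Fin.equivSubtype i

theorem permNat_of_le {n : ℕ} (π : Equiv.Perm (Fin n)) {v : ℕ} (hv : n ≤ v) :
    permNat π v = v :=
  π.extendDomain_apply_not_subtype Fin.equivSubtype (by omega)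

/-- The patterns of the positions of the values `2k, 2k+1, 2k+2`. -/
def patternColor {n : ℕ} (π : Equiv.Perm (Fin n)) (k : Fin (n / 2)) : Bool :=
  patternParity ((permNat π).symm (2 * k)) ((permNat π).symm (2 * k + 1))
    ((permNat π).symm (2 * k + 2))

theorem exists_two_le_of_patternColor_eq {n : ℕ} {π σ : Equiv.Perm (Fin n)}
    (hc : patternColor π = patternColor σ) (hne : π ≠ σ) :
    ∃ i : Fin n, 2 ≤ ((π i : ℤ) - (σ i : ℤ)).natAbs := by
  by_contra! h
  refine hne ?_
  have heq : permNat π = permNat σ := by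
    refine eq_of_patternParity_eq (n := n) (fun v => permNat_of_le π) (fun v => permNat_of_le σ)
      (fun i => ?_) (fun k hk => congrFun hc ⟨k, hk⟩)
    by_cases hi : i < n
    · have := h ⟨i, hi⟩
      rw [permNat_val π ⟨i, hi⟩, permNat_val σ ⟨i, hi⟩]
      omega
    · rw [permNat_of_le π (by omega), permNat_of_le σ (by omega)]
      omega
  ext i
  rw [← permNat_val, ← permNat_val, heq]

/-- The involution exchanging `2k` and `2k+1` for each `k` with `e k`. -/
def pairFlip {n : ℕ} (e : Fin (n / 2) → Bool) : Equiv.Perm (Fin n) :=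
  Function.Involutive.toPerm
    (fun v => if h : v / 2 < n / 2 then
        if e ⟨v / 2, h⟩ then ⟨if v.val % 2 = 0 then v + 1 else v - 1, by split <;> omega⟩ else v
      else v)
    (by
      intro v
      by_cases h : v.val / 2 < n / 2
      · by_cases he : e ⟨v / 2, h⟩ = true
        · have hq : (if v.val % 2 = 0 then v.val + 1 else v.val - 1) / 2 = v.val / 2 := by
            split <;> omega
          simp only [h, he, hq, dite_true, if_true]
          ext
          dsimp only
          split_ifs <;> omega
        · simp [h, he]
      · simp [h])

theorem pairFlip_val {n : ℕ} (e : Fin (n / 2) → Bool) (v : Fin n) :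
    (pairFlip e v : ℕ) = if h : v.val / 2 < n / 2 then
        if e ⟨v / 2, h⟩ then if v.val % 2 = 0 then v.val + 1 else v.val - 1 else v.val
      else v.val := by
  change Fin.val (dite _ _ _) = _
  split_ifs <;> simp_all

theorem pairFlip_apply_div_two {n : ℕ} (e : Fin (n / 2) → Bool) (v : Fin n) :
    (pairFlip e v : ℕ) / 2 = v / 2 := by
  rw [pairFlip_val]
  split_ifs <;> omega

theorem pairFlip_injective (n : ℕ) :
    Function.Injective (pairFlip : (Fin (n / 2) → Bool) → Equiv.Perm (Fin n)) := by
  intro e f hef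
  funext k
  have hk : 2 * k.val / 2 = k := by omega
  have h := congrArg Fin.val (DFunLike.congr_fun hef ⟨2 * k, by omega⟩)
  simp only [pairFlip_val, hk, k.isLt, dite_true] at h
  by_cases he : e k <;> by_cases hf : f k <;> simp_all

theorem card_mul_two_pow_le_factorial {n : ℕ} {S : Finset (Equiv.Perm (Fin n))}
    (hS : ∀ π ∈ S, ∀ σ ∈ S, π ≠ σ → ∃ i : Fin n, 2 ≤ ((π i : ℤ) - (σ i : ℤ)).natAbs) :
    S.card * 2 ^ (n / 2) ≤ n.factorial := by
  have hinj : Function.Injective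
      (fun p : S × (Fin (n / 2) → Bool) => pairFlip p.2 * p.1.1) := by
    rintro ⟨⟨π, hπ⟩, e⟩ ⟨⟨σ, hσ⟩, f⟩ h
    dsimp only at h
    have hπσ : π = σ := by
      by_contra hne
      obtain ⟨i, hi⟩ := hS π hπ σ hσ hne
      have h₁ := pairFlip_apply_div_two e (π i)
      have h₂ := pairFlip_apply_div_two f (σ i)
      have h₃ : pairFlip e (π i) = pairFlip f (σ i) := DFunLike.congr_fun h i
      rw [h₃] at h₁
      omega
    subst hπσ
    rw [pairFlip_injective n (mul_right_cancel h)]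
  simpa [Fintype.card_perm] using Fintype.card_le_of_injective _ hinj

theorem exists_patternColor_fiber (n : ℕ) :
    ∃ c : Fin (n / 2) → Bool, n.factorial / 2 ^ (n / 2) ≤
      (Finset.univ.filter fun π : Equiv.Perm (Fin n) => patternColor π = c).card := by
  refine Fintype.exists_le_card_fiber_of_mul_le_card patternColor ?_
  simpa [Fintype.card_perm] using Nat.mul_div_le _ _

/-- Theorem 1: `T(n, complement of {1}) = n! / 2 ^ ⌊n/2⌋`. -/
theorem T_compl_one (n : ℕ) (hn : 1 ≤ n) :
    T n {d : ℕ | 2 ≤ d} = Nat.factorial n / 2 ^ (n / 2) := by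
  have hub : ∀ k ∈ {k | ∃ S : Finset (Equiv.Perm (Fin n)), S.card = k ∧
      ∀ π ∈ S, ∀ σ ∈ S, π ≠ σ →
        ∃ i : Fin n, ((π i : ℤ) - (σ i : ℤ)).natAbs ∈ {d : ℕ | 2 ≤ d}},
      k ≤ Nat.factorial n / 2 ^ (n / 2) := by
    rintro k ⟨S, rfl, hS⟩
    exact (Nat.le_div_iff_mul_le (by positivity)).2 (card_mul_two_pow_le_factorial hS)
  refine le_antisymm (csSup_le ⟨0, ∅, by simp⟩ hub) ?_
  obtain ⟨c, hc⟩ := exists_patternColor_fiber n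
  refine hc.trans (le_csSup ⟨_, hub⟩ ⟨_, rfl, fun π hπ σ hσ hne => ?_⟩)
  rw [Finset.mem_filter] at hπ hσ
  exact exists_two_le_of_patternColor_eq (hπ.2.trans hσ.2.symm) hne
end

section
/- Let q ≥ 1 be a natural number and write n = aq + m with m ∈ {0,…,q−1}. Then T(n, D) = n! / ( (2^⌊a/2⌋)^{q−m} · (2^⌊(a+1)/2⌋)^{m} ), where D = {1,2,3,…} \ {q} is the complement of {q} in the positive integers. -/
/-- The lower ends `x` of the edges `{x, x + q}` in a maximum matching of the graph on
`{0, …, n - 1}` joining numbers at distance `q`. -/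
def matchingStarts (q n : ℕ) : Finset ℕ :=
  {x ∈ Finset.range n | x + q < n ∧ (x / q) % 2 = 0}

theorem mem_matchingStarts {q n x : ℕ} :
    x ∈ matchingStarts q n ↔ x + q < n ∧ (x / q) % 2 = 0 := by
  simp only [matchingStarts, Finset.mem_filter, Finset.mem_range]
  omega

theorem add_mul_lt_iff {q a m r k : ℕ} (hm : m < q) (hr : r < q) :
    r + k * q < a * q + m ↔ k < a ∨ (k = a ∧ r < m) := by
  rcases lt_trichotomy k a with h | h | h
  · have := Nat.mul_le_mul_right q (Nat.succ_le_of_lt h)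
    rw [Nat.succ_mul] at this
    omega
  · subst h
    omega
  · have := Nat.mul_le_mul_right q (Nat.succ_le_of_lt h)
    rw [Nat.succ_mul] at this
    omega

theorem card_matchingStarts {q a m : ℕ} (hm : m < q) :
    (matchingStarts q (a * q + m)).card = (a / 2) * (q - m) + ((a + 1) / 2) * m := by
  have hq : 0 < q := by omega
  have hbij : (matchingStarts q (a * q + m)).card =
      ((Finset.range q).sigma
        (fun r => Finset.range (if r < m then (a + 1) / 2 else a / 2))).card := by
    refine Finset.card_bij' (fun x _ => ⟨x % q, x / q / 2⟩) (fun p _ => p.1 + (2 * p.2) * q)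
      ?_ ?_ ?_ ?_
    · intro x hx
      obtain ⟨h1, h2⟩ := mem_matchingStarts.1 hx
      have hr := Nat.mod_lt x hq
      have h3 : x + q = x % q + (x / q + 1) * q := by
        rw [Nat.succ_mul, ← add_assoc, Nat.mod_add_div']
      rw [h3, add_mul_lt_iff hm hr] at h1
      simp only [Finset.mem_sigma, Finset.mem_range]
      refine ⟨hr, ?_⟩
      split_ifs <;> omega
    · rintro ⟨r, j⟩ hp
      simp only [Finset.mem_sigma, Finset.mem_range] at hp
      obtain ⟨hr, hj⟩ := hp
      rw [mem_matchingStarts]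
      refine ⟨?_, ?_⟩
      · have h3 : r + 2 * j * q + q = r + (2 * j + 1) * q := by ring
        simp only [h3]
        rw [add_mul_lt_iff hm hr]
        split_ifs at hj <;> omega
      · simp [Nat.add_mul_div_right _ _ hq, Nat.div_eq_of_lt hr]
    · intro x hx
      obtain ⟨h1, h2⟩ := mem_matchingStarts.1 hx
      have h4 : 2 * (x / q / 2) = x / q := by omega
      simp only [h4]
      exact Nat.mod_add_div' x q
    · rintro ⟨r, j⟩ hp
      simp only [Finset.mem_sigma, Finset.mem_range] at hp
      obtain ⟨hr, hj⟩ := hp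
      simp [Nat.add_mul_div_right _ _ hq, Nat.div_eq_of_lt hr, Nat.mod_eq_of_lt hr]
  rw [hbij, Finset.card_sigma]
  simp only [Finset.card_range]
  rw [Finset.sum_ite, Finset.sum_const, Finset.sum_const]
  have h1 : ({x ∈ Finset.range q | x < m}).card = m := by
    have : {x ∈ Finset.range q | x < m} = Finset.range m := by
      ext x
      simp only [Finset.mem_filter, Finset.mem_range]
      omega
    rw [this, Finset.card_range]
  have h2 : ({x ∈ Finset.range q | ¬ x < m}).card = q - m := by
    have := Finset.card_filter_add_card_filter_not (s := Finset.range q) (fun x => x < m)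
    rw [h1, Finset.card_range] at this
    omega
  rw [h1, h2, smul_eq_mul, smul_eq_mul]
  ring

/-- The map exchanging `x` and `x + q` for all `x ∈ A`. -/
def matchingSwapFun (q : ℕ) (A : Finset ℕ) (x : ℕ) : ℕ :=
  if x ∈ A then x + q else if q ≤ x ∧ x - q ∈ A then x - q else x

theorem add_notMem_matchingStarts {q n x : ℕ} (hq : 0 < q) (hx : x ∈ matchingStarts q n) :
    x + q ∉ matchingStarts q n := by
  rw [mem_matchingStarts] at hx ⊢
  rw [Nat.add_div_right _ hq]
  omega

theorem matchingSwapFun_lt {q n x : ℕ} {A : Finset ℕ} (hA : A ⊆ matchingStarts q n)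
    (hx : x < n) : matchingSwapFun q A x < n := by
  unfold matchingSwapFun
  split_ifs with h
  · exact (mem_matchingStarts.1 (hA h)).1
  · omega
  · exact hx

theorem matchingSwapFun_involutive {q n : ℕ} {A : Finset ℕ} (hq : 0 < q)
    (hA : A ⊆ matchingStarts q n) : Function.Involutive (matchingSwapFun q A) := by
  intro x
  by_cases h : x ∈ A
  · have h1 : x + q ∉ A := fun h' => add_notMem_matchingStarts hq (hA h) (hA h')
    simp [matchingSwapFun, h, h1]
  · by_cases h2 : q ≤ x ∧ x - q ∈ A
    · have h3 : x - q + q = x := by omega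
      simp [matchingSwapFun, h, h2, h3]
    · simp only [matchingSwapFun, h, h2, if_false]

/-- The permutation exchanging `x` and `x + q` for all `x ∈ A`. -/
def matchingSwap {q n : ℕ} (hq : 0 < q) (A : Finset ℕ) (hA : A ⊆ matchingStarts q n) :
    Equiv.Perm (Fin n) :=
  Function.Involutive.toPerm (fun x => ⟨matchingSwapFun q A x, matchingSwapFun_lt hA x.2⟩)
    fun x => Fin.ext (matchingSwapFun_involutive hq hA x)

theorem matchingSwap_val {q n : ℕ} (hq : 0 < q) (A : Finset ℕ) (hA : A ⊆ matchingStarts q n)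
    (x : Fin n) : (matchingSwap hq A hA x : ℕ) = matchingSwapFun q A x := rfl

theorem matchingSwap_injective {q n : ℕ} (hq : 0 < q) {A B : Finset ℕ}
    (hA : A ⊆ matchingStarts q n) (hB : B ⊆ matchingStarts q n)
    (h : matchingSwap hq A hA = matchingSwap hq B hB) : A = B := by
  have key : ∀ x : ℕ, x < n → matchingSwapFun q A x = matchingSwapFun q B x := fun x hx => by
    have := congrArg Fin.val (Equiv.congr_fun h ⟨x, hx⟩)
    simpa only [matchingSwap_val] using this
  have hmem : ∀ (C : Finset ℕ) (x : ℕ), x ∈ C ↔ matchingSwapFun q C x = x + q := by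
    intro C x
    unfold matchingSwapFun
    split_ifs <;> simp_all <;> omega
  ext x
  constructor
  · intro hx
    rw [hmem, ← key x (by have := mem_matchingStarts.1 (hA hx); omega), ← hmem]
    exact hx
  · intro hx
    rw [hmem, key x (by have := mem_matchingStarts.1 (hB hx); omega), ← hmem]
    exact hx

theorem natAbs_sub_of_matchingSwapFun_eq {q n x y : ℕ} {A B : Finset ℕ} (hq : 0 < q)
    (hA : A ⊆ matchingStarts q n) (hB : B ⊆ matchingStarts q n)
    (h : matchingSwapFun q A x = matchingSwapFun q B y) :
    ((x : ℤ) - y).natAbs = 0 ∨ ((x : ℤ) - y).natAbs = q := by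
  have hx := matchingSwapFun_involutive hq hA x
  have hy := matchingSwapFun_involutive hq hB y
  rw [← h] at hy
  generalize matchingSwapFun q A x = z at hx hy
  rw [← hx, ← hy]
  unfold matchingSwapFun
  by_cases h1 : z ∈ A <;> by_cases h2 : z ∈ B
  · simp [h1, h2]
  · have h3 : ¬ (q ≤ z ∧ z - q ∈ B) := fun h3 => by
      have := add_notMem_matchingStarts hq (hB h3.2)
      rw [Nat.sub_add_cancel h3.1] at this
      exact this (hA h1)
    simp [h1, h2, h3]
  · have h3 : ¬ (q ≤ z ∧ z - q ∈ A) := fun h3 => by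
      have := add_notMem_matchingStarts hq (hA h3.2)
      rw [Nat.sub_add_cancel h3.1] at this
      exact this (hB h2)
    simp [h1, h2, h3]
  · simp only [h1, h2, if_false]
    split_ifs <;> omega

theorem card_mul_two_pow_le {q n : ℕ} (hq : 0 < q) (S : Finset (Equiv.Perm (Fin n)))
    (hS : ∀ π ∈ S, ∀ σ ∈ S, π ≠ σ →
      ∃ i : Fin n, ((π i : ℤ) - (σ i : ℤ)).natAbs ∈ {d : ℕ | 0 < d ∧ d ≠ q}) :
    S.card * 2 ^ (matchingStarts q n).card ≤ n.factorial := by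
  have hcard : Fintype.card (S × (matchingStarts q n).powerset) =
      S.card * 2 ^ (matchingStarts q n).card := by
    rw [Fintype.card_prod, Fintype.card_coe, Fintype.card_coe, Finset.card_powerset]
  have hperm : Fintype.card (Equiv.Perm (Fin n)) = n.factorial := by
    rw [Fintype.card_perm, Fintype.card_fin]
  rw [← hcard, ← hperm]
  refine Fintype.card_le_of_injective
    (fun p => matchingSwap hq p.2.1 (Finset.mem_powerset.1 p.2.2) * p.1.1) ?_
  rintro ⟨⟨π, hπ⟩, ⟨A, hA⟩⟩ ⟨⟨σ, hσ⟩, ⟨B, hB⟩⟩ h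
  have hA' := Finset.mem_powerset.1 hA
  have hB' := Finset.mem_powerset.1 hB
  change matchingSwap hq A hA' * π = matchingSwap hq B hB' * σ at h
  have hπσ : π = σ := by
    by_contra hne
    obtain ⟨i, hi0, hiq⟩ := hS π hπ σ hσ hne
    have hi := congrArg Fin.val (Equiv.congr_fun h i)
    rw [Equiv.Perm.mul_apply, Equiv.Perm.mul_apply, matchingSwap_val, matchingSwap_val] at hi
    have := natAbs_sub_of_matchingSwapFun_eq hq hA' hB' hi
    omega
  subst hπσ
  have hAB : A = B := matchingSwap_injective hq hA' hB' (mul_right_cancel h)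
  subst hAB
  rfl

/-- The orientation (parity of the relative order) of three numbers. -/
def orientation3 (a b c : ℕ) : Bool :=
  xor (decide (a < b)) (xor (decide (b < c)) (decide (a < c)))

theorem orientation3_swap_left {a b c : ℕ} (h : a ≠ b) :
    orientation3 b a c = !orientation3 a b c := by
  unfold orientation3
  rcases lt_or_gt_of_ne h with h | h
  · have h' : ¬ b < a := by omega
    simp only [h, h', decide_true, decide_false]
    cases decide (a < c) <;> cases decide (b < c) <;> rfl
  · have h' : ¬ a < b := by omega
    simp only [h, h', decide_true, decide_false]
    cases decide (a < c) <;> cases decide (b < c) <;> rfl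

theorem orientation3_swap_right {a b c : ℕ} (h : b ≠ c) :
    orientation3 a c b = !orientation3 a b c := by
  unfold orientation3
  rcases lt_or_gt_of_ne h with h | h
  · have h' : ¬ c < b := by omega
    simp only [h, h', decide_true, decide_false]
    cases decide (a < b) <;> cases decide (a < c) <;> rfl
  · have h' : ¬ b < c := by omega
    simp only [h, h', decide_true, decide_false]
    cases decide (a < b) <;> cases decide (a < c) <;> rfl

/-- The position of the value `x` in the permutation `π`, and `n` if there is no such value. -/
def valuePos {n : ℕ} (π : Equiv.Perm (Fin n)) (x : ℕ) : ℕ :=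
  if h : x < n then (π.symm ⟨x, h⟩ : ℕ) else n

theorem valuePos_val {n : ℕ} (π : Equiv.Perm (Fin n)) (x : Fin n) :
    valuePos π x = π.symm x := by
  simp [valuePos]

theorem valuePos_of_le {n x : ℕ} (π : Equiv.Perm (Fin n)) (h : n ≤ x) : valuePos π x = n := by
  simp [valuePos, h]

theorem valuePos_ne {n x y : ℕ} (π : Equiv.Perm (Fin n)) (hx : x < n) (hy : y < n)
    (h : x ≠ y) : valuePos π x ≠ valuePos π y := by
  simp only [valuePos, hx, hy, dif_pos]
  intro h'
  have := π.symm.injective (Fin.ext h')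
  simp only [Fin.mk.injEq] at this
  exact h this

/-- The starts `x` of matching edges whose triple `x, x + q, x + 2q` is positively oriented. -/
def orientationColor (q : ℕ) {n : ℕ} (π : Equiv.Perm (Fin n)) : Finset ℕ :=
  {x ∈ matchingStarts q n |
    orientation3 (valuePos π x) (valuePos π (x + q)) (valuePos π (x + 2 * q)) = true}

theorem orientation3_eq_of_orientationColor_eq {q n x : ℕ} {π σ : Equiv.Perm (Fin n)}
    (h : orientationColor q π = orientationColor q σ) (hx : x ∈ matchingStarts q n) :
    orientation3 (valuePos π x) (valuePos π (x + q)) (valuePos π (x + 2 * q)) =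
      orientation3 (valuePos σ x) (valuePos σ (x + q)) (valuePos σ (x + 2 * q)) := by
  have := Finset.ext_iff.1 h x
  simp only [orientationColor, Finset.mem_filter, hx, true_and] at this
  exact Bool.eq_iff_iff.2 this

theorem perm_apply_add_of_displacement {q n : ℕ} (hq : 0 < q) {τ : Equiv.Perm (Fin n)}
    (hτ : ∀ x, (τ x : ℕ) = x ∨ (τ x : ℕ) = x + q ∨ (τ x : ℕ) + q = x) (k : ℕ) :
    ∀ x y : Fin n, (x : ℕ) = k → τ x = y → (y : ℕ) = x + q → τ y = x := by
  induction k using Nat.strong_induction_on with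
  | _ k ih =>
    intro x y hk hxy hy
    obtain ⟨z, hz⟩ := τ.surjective x
    rcases hτ z with h | h | h <;> rw [hz] at h
    · have : z = x := Fin.ext h.symm
      subst this
      rw [hz] at hxy
      subst hxy
      omega
    · have := ih z (by omega) z x rfl hz h
      rw [hxy] at this
      subst this
      omega
    · have : z = y := Fin.ext (by omega)
      rw [← this, hz]

theorem perm_involutive_of_displacement {q n : ℕ} (hq : 0 < q) {τ : Equiv.Perm (Fin n)}
    (hτ : ∀ x, (τ x : ℕ) = x ∨ (τ x : ℕ) = x + q ∨ (τ x : ℕ) + q = x) (x : Fin n) :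
    τ (τ x) = x := by
  rcases hτ x with h | h | h
  · have : τ x = x := Fin.ext h
    rw [this, this]
  · exact perm_apply_add_of_displacement hq hτ x x _ rfl rfl h
  · have hτ' : ∀ x, (τ.symm x : ℕ) = x ∨ (τ.symm x : ℕ) = x + q ∨ (τ.symm x : ℕ) + q = x := by
      intro x
      have := hτ (τ.symm x)
      rw [Equiv.apply_symm_apply] at this
      omega
    have := perm_apply_add_of_displacement hq hτ' _ (τ x) x rfl (τ.symm_apply_apply x) h.symm
    rw [← this, Equiv.apply_symm_apply]

theorem exists_natAbs_of_orientationColor_eq {q n : ℕ} (hq : 0 < q) {π σ : Equiv.Perm (Fin n)}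
    (hne : π ≠ σ) (hc : orientationColor q π = orientationColor q σ) :
    ∃ i : Fin n, ((π i : ℤ) - (σ i : ℤ)).natAbs ∈ {d : ℕ | 0 < d ∧ d ≠ q} := by
  by_contra! hcon
  simp only [Set.mem_ofPred_eq, not_and, not_not] at hcon
  obtain ⟨τ, hτdef⟩ : ∃ τ : Equiv.Perm (Fin n), τ = σ * π⁻¹ := ⟨_, rfl⟩
  have hτπ : ∀ i, τ (π i) = σ i := by simp [hτdef]
  have hτ : ∀ x, (τ x : ℕ) = x ∨ (τ x : ℕ) = x + q ∨ (τ x : ℕ) + q = x := by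
    intro x
    obtain ⟨i, rfl⟩ := π.surjective x
    rw [hτπ]
    have := hcon i
    omega
  have hinv := perm_involutive_of_displacement hq hτ
  have hpos : ∀ x : Fin n, valuePos σ (τ x) = valuePos π x := by
    intro x
    rw [valuePos_val, valuePos_val]
    obtain ⟨i, rfl⟩ := π.surjective x
    rw [hτπ, Equiv.symm_apply_apply, Equiv.symm_apply_apply]
  have hfix : ∀ x : Fin n, (τ x : ℕ) = x → valuePos σ x = valuePos π x := by
    intro x hx
    rw [← hpos x, hx]
  have hup : ∀ x : Fin n, (τ x : ℕ) = x + q →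
      valuePos σ (x + q) = valuePos π x ∧ valuePos σ x = valuePos π (x + q) := by
    intro x hx
    refine ⟨by rw [← hpos x, hx], ?_⟩
    rw [← hx, ← hpos (τ x), hinv]
  let U : Finset (Fin n) := {x | (τ x : ℕ) = x + q}
  have hU : ∀ x, x ∈ U ↔ (τ x : ℕ) = x + q := by simp [U]
  have hUne : U.Nonempty := by
    have hτ1 : ∃ x, τ x ≠ x := by
      by_contra! h
      exact hne (Equiv.ext fun i => by rw [← hτπ, h])
    obtain ⟨x, hx⟩ := hτ1
    rcases hτ x with h | h | h
    · exact absurd (Fin.ext h) hx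
    · exact ⟨x, (hU x).2 h⟩
    · exact ⟨τ x, (hU _).2 (by rw [hinv, h])⟩
  by_cases hV : ({x ∈ U | ((x : ℕ) / q) % 2 = 0} : Finset (Fin n)).Nonempty
  · obtain ⟨x, hx, hmax⟩ := Finset.exists_max_image _ id hV
    simp only [Finset.mem_filter, hU, id] at hx hmax
    obtain ⟨hx, heven⟩ := hx
    have hlt : (x : ℕ) + q < n := hx ▸ (τ x).2
    have hE : (x : ℕ) ∈ matchingStarts q n := mem_matchingStarts.2 ⟨hlt, heven⟩
    obtain ⟨h1, h2⟩ := hup x hx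
    have h3 : valuePos σ (x + 2 * q) = valuePos π (x + 2 * q) := by
      by_cases hy : (x : ℕ) + 2 * q < n
      · apply hfix ⟨_, hy⟩
        rcases hτ ⟨_, hy⟩ with h | h | h
        · exact h
        · have hdiv : ((x : ℕ) + 2 * q) / q = x / q + 2 := Nat.add_mul_div_right _ _ hq
          have := hmax ⟨_, hy⟩ ⟨h, by simp only [hdiv]; omega⟩
          rw [Fin.le_def] at this
          simp only at this
          omega
        · have : τ ⟨_, hy⟩ = τ x := Fin.ext (by simp only at h; omega)
          have := congrArg Fin.val (τ.injective this)
          simp only at this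
          omega
      · rw [valuePos_of_le _ (by omega), valuePos_of_le _ (by omega)]
    have := orientation3_eq_of_orientationColor_eq hc hE
    rw [h1, h2, h3, orientation3_swap_left
      (valuePos_ne π x.2 hlt (by omega))] at this
    simp at this
  · rw [Finset.not_nonempty_iff_eq_empty, Finset.filter_eq_empty_iff] at hV
    obtain ⟨x, hx, hmin⟩ := Finset.exists_min_image _ id hUne
    have hodd := hV hx
    simp only [hU, id] at hx hmin
    have hqx : q ≤ x := by
      by_contra! h
      simp [Nat.div_eq_of_lt h] at hodd
    obtain ⟨y, hy⟩ := Nat.exists_eq_add_of_le' hqx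
    have hyn : y < n := by omega
    have hdiv : (x : ℕ) / q = y / q + 1 := by rw [hy, Nat.add_div_right _ hq]
    have hyeven : (y / q) % 2 = 0 := by omega
    have hE : y ∈ matchingStarts q n := mem_matchingStarts.2 ⟨by omega, hyeven⟩
    obtain ⟨h1, h2⟩ := hup x hx
    have hlt : (x : ℕ) + q < n := hx ▸ (τ x).2
    have h3 : valuePos σ y = valuePos π y := by
      apply hfix ⟨y, hyn⟩
      rcases hτ ⟨y, hyn⟩ with h | h | h
      · exact h
      · exact absurd hyeven (hV ((hU ⟨y, hyn⟩).2 h))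
      · have := hmin (τ ⟨y, hyn⟩) (by rw [hinv, h])
        rw [Fin.le_def] at this
        simp only at h
        omega
    have := orientation3_eq_of_orientationColor_eq hc hE
    have hy2 : y + 2 * q = x + q := by omega
    rw [hy2, ← hy, h1, h2, h3, orientation3_swap_right
      (valuePos_ne π x.2 hlt (by omega))] at this
    simp at this

/-- Corollary: for `n = a q + m` with `0 ≤ m < q`,
`T(n, complement of {q}) = n! / ((2^⌊a/2⌋)^(q-m) · (2^⌊(a+1)/2⌋)^m)`. -/
theorem T_compl_q (q a m n : ℕ) (hq : 1 ≤ q) (hm : m < q) (hn : n = a * q + m) :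
    T n {d : ℕ | 0 < d ∧ d ≠ q} =
      Nat.factorial n / ((2 ^ (a / 2)) ^ (q - m) * (2 ^ ((a + 1) / 2)) ^ m) := by
  have hpow : (2 ^ (a / 2)) ^ (q - m) * (2 ^ ((a + 1) / 2)) ^ m =
      2 ^ (matchingStarts q n).card := by
    rw [hn, card_matchingStarts hm, ← pow_mul, ← pow_mul, ← pow_add]
  rw [hpow]
  have hub : ∀ S : Finset (Equiv.Perm (Fin n)), (∀ π ∈ S, ∀ σ ∈ S, π ≠ σ →
      ∃ i : Fin n, ((π i : ℤ) - (σ i : ℤ)).natAbs ∈ {d : ℕ | 0 < d ∧ d ≠ q}) →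
      S.card ≤ n.factorial / 2 ^ (matchingStarts q n).card := fun S hS =>
    (Nat.le_div_iff_mul_le (by positivity)).2 (card_mul_two_pow_le hq S hS)
  obtain ⟨c, -, hc⟩ := Finset.exists_le_card_fiber_of_mul_le_card_of_maps_to
    (s := (Finset.univ : Finset (Equiv.Perm (Fin n)))) (t := (matchingStarts q n).powerset)
    (f := orientationColor q) (n := n.factorial / 2 ^ (matchingStarts q n).card)
    (fun π _ => Finset.mem_powerset.2 (Finset.filter_subset _ _))
    ⟨∅, Finset.empty_mem_powerset _⟩
    (by
      rw [Finset.card_powerset, Finset.card_univ, Fintype.card_perm, Fintype.card_fin]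
      exact Nat.mul_div_le _ _)
  have hclique : ∀ π ∈ ({π | orientationColor q π = c} : Finset (Equiv.Perm (Fin n))),
      ∀ σ ∈ ({π | orientationColor q π = c} : Finset (Equiv.Perm (Fin n))), π ≠ σ →
      ∃ i : Fin n, ((π i : ℤ) - (σ i : ℤ)).natAbs ∈ {d : ℕ | 0 < d ∧ d ≠ q} := by
    intro π hπ σ hσ hne
    simp only [Finset.mem_filter, Finset.mem_univ, true_and] at hπ hσ
    exact exists_natAbs_of_orientationColor_eq hq hne (hπ.trans hσ.symm)
  refine IsGreatest.csSup_eq ⟨⟨_, le_antisymm (hub _ hclique) hc, hclique⟩, ?_⟩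
  rintro k ⟨S, rfl, hS⟩
  exact hub S hS
end

section
/- The split strength of the partition ({1}, {2,3,4,…}) of the positive integers satisfies 0.33 < φ({1}, complement of {1}) ≤ 1/2. -/
open Filter

/-- The split strength `φ(D, D̄) = limsup (1/n) log₂ (T(n,D)·T(n,D̄)/n!)`. -/
noncomputable def splitStrength (D Dc : Set ℕ) : ℝ :=
  Filter.atTop.limsup fun n : ℕ =>
    Real.logb 2 ((T n D : ℝ) * (T n Dc : ℝ) / (Nat.factorial n : ℝ)) / n

/-! ### Families of pairwise different permutations -/

/-- Pairwise `G(D)`-different sets of permutations of `Fin n`. -/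
def PairwiseDifferent (n : ℕ) (D : Set ℕ) (S : Finset (Equiv.Perm (Fin n))) : Prop :=
  ∀ π ∈ S, ∀ σ ∈ S, π ≠ σ → ∃ i : Fin n, ((π i : ℤ) - (σ i : ℤ)).natAbs ∈ D

theorem PairwiseDifferent.card_le_T {n : ℕ} {D : Set ℕ} {S : Finset (Equiv.Perm (Fin n))}
    (hS : PairwiseDifferent n D S) : S.card ≤ T n D := by
  refine le_csSup ⟨Fintype.card (Equiv.Perm (Fin n)), ?_⟩ ⟨S, rfl, hS⟩
  rintro k ⟨S', rfl, -⟩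
  exact Finset.card_le_univ S'

theorem exists_pairwiseDifferent_card_eq_T (n : ℕ) (D : Set ℕ) :
    ∃ S : Finset (Equiv.Perm (Fin n)), S.card = T n D ∧ PairwiseDifferent n D S := by
  refine Nat.sSup_mem (s := {k | ∃ S : Finset (Equiv.Perm (Fin n)), S.card = k ∧
    PairwiseDifferent n D S}) ⟨0, ∅, rfl, by simp [PairwiseDifferent]⟩
    ⟨Fintype.card (Equiv.Perm (Fin n)), ?_⟩
  rintro k ⟨S', rfl, -⟩
  exact Finset.card_le_univ S'

theorem one_le_T (n : ℕ) (D : Set ℕ) : 1 ≤ T n D := by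
  have h : PairwiseDifferent n D {1} := by
    intro π hπ σ hσ hne
    simp_all
  simpa using h.card_le_T

/-- A family of permutations of `{0, …, n - 1}`, written as functions on `ℕ`, any two of which
collide, bounds `T n {1}` from below. -/
theorem card_le_T_one {ι : Type*} [Fintype ι] (n : ℕ) (f : ι → ℕ → ℕ)
    (hlt : ∀ a, ∀ k < n, f a k < n) (hinj : ∀ a, Set.InjOn (f a) (Set.Iio n))
    (hdiff : ∀ a b, a ≠ b → ∃ i < n, ((f a i : ℤ) - f b i).natAbs = 1) :
    Fintype.card ι ≤ T n {1} := by
  classical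
  have hbij (a : ι) : Function.Bijective fun k : Fin n => (⟨f a k, hlt a k k.2⟩ : Fin n) :=
    Finite.injective_iff_bijective.mp fun x y hxy =>
      Fin.ext (hinj a x.2 y.2 (Fin.mk.inj_iff.mp hxy))
  let g (a : ι) : Equiv.Perm (Fin n) := Equiv.ofBijective _ (hbij a)
  have hg (a b : ι) (hab : a ≠ b) :
      ∃ i : Fin n, ((g a i : ℤ) - (g b i : ℤ)).natAbs ∈ ({1} : Set ℕ) := by
    obtain ⟨i, hi, h⟩ := hdiff a b hab
    exact ⟨⟨i, hi⟩, h⟩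
  have ginj : Function.Injective g := by
    intro a b hab
    by_contra hne
    obtain ⟨i, hi⟩ := hg a b hne
    simp [hab] at hi
  have hS : PairwiseDifferent n {1} (Finset.univ.image g) := by
    intro π hπ σ hσ hne
    obtain ⟨a, -, rfl⟩ := Finset.mem_image.mp hπ
    obtain ⟨b, -, rfl⟩ := Finset.mem_image.mp hσ
    exact hg a b fun h => hne (h ▸ rfl)
  simpa [Finset.card_image_of_injective _ ginj] using hS.card_le_T

/-! ### Upper bounds -/

theorem T_one_le (n : ℕ) : T n {1} ≤ 2 ^ n := by
  obtain ⟨S, hcard, hS⟩ := exists_pairwiseDifferent_card_eq_T n {1}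
  rw [← hcard]
  let parity (π : Equiv.Perm (Fin n)) (i : Fin n) : Fin 2 := Fin.ofNat 2 (π i)
  have hinj : Set.InjOn parity S := by
    intro π hπ σ hσ h
    by_contra hne
    obtain ⟨i, hi⟩ := hS π hπ σ hσ hne
    have h1 := congrArg Fin.val (congrFun h i)
    simp only [parity, Fin.ofNat, Set.mem_singleton_iff] at h1 hi
    omega
  calc S.card ≤ (Finset.univ : Finset (Fin n → Fin 2)).card :=
        Finset.card_le_card_of_injOn parity (fun _ _ => Finset.mem_univ _) hinj
    _ = 2 ^ n := by simp

/-- Exchange `2j` and `2j + 1` for every `j` with `b j`, as a map on `ℕ`. -/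
def flipPairs (b : ℕ → Bool) (v : ℕ) : ℕ :=
  if b (v / 2) then (if v % 2 = 0 then v + 1 else v - 1) else v

theorem flipPairs_div_two (b : ℕ → Bool) (v : ℕ) : flipPairs b v / 2 = v / 2 := by
  unfold flipPairs
  split_ifs <;> omega

theorem flipPairs_flipPairs (b : ℕ → Bool) (v : ℕ) : flipPairs b (flipPairs b v) = v := by
  have h := flipPairs_div_two b v
  rw [flipPairs, h]
  unfold flipPairs
  split_ifs <;> omega

theorem flipPairs_lt {n : ℕ} {b : ℕ → Bool} (hb : ∀ j, n / 2 ≤ j → b j = false) {v : ℕ}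
    (hv : v < n) : flipPairs b v < n := by
  unfold flipPairs
  split_ifs with h1 h2
  · by_cases h : n / 2 ≤ v / 2
    · simp [hb _ h] at h1
    · omega
  · omega
  · exact hv

theorem T_two_le_mul (n : ℕ) : T n {d : ℕ | 2 ≤ d} * 2 ^ (n / 2) ≤ n.factorial := by
  obtain ⟨S, hcard, hS⟩ := exists_pairwiseDifferent_card_eq_T n {d : ℕ | 2 ≤ d}
  rw [← hcard]
  let ext (b : Fin (n / 2) → Bool) (j : ℕ) : Bool := if h : j < n / 2 then b ⟨j, h⟩ else false
  have hext (b : Fin (n / 2) → Bool) : ∀ j, n / 2 ≤ j → ext b j = false := by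
    intro j hj
    simp [ext, hj]
  let τ (b : Fin (n / 2) → Bool) : Equiv.Perm (Fin n) :=
    Function.Involutive.toPerm (fun v => ⟨flipPairs (ext b) v, flipPairs_lt (hext b) v.2⟩)
      fun v => Fin.ext (flipPairs_flipPairs _ _)
  have hinj : Set.InjOn (fun x : Equiv.Perm (Fin n) × (Fin (n / 2) → Bool) => τ x.2 * x.1)
      (S ×ˢ (Finset.univ : Finset (Fin (n / 2) → Bool)) : Finset _) := by
    rintro ⟨π, b⟩ hx ⟨σ, c⟩ hy h
    have hπ : π ∈ S := (Finset.mem_product.mp hx).1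
    have hσ : σ ∈ S := (Finset.mem_product.mp hy).1
    have hval (i : Fin n) : flipPairs (ext b) (π i) = flipPairs (ext c) (σ i) :=
      congrArg Fin.val (DFunLike.congr_fun h i)
    have hπσ : π = σ := by
      by_contra hne
      obtain ⟨i, hi⟩ := hS π hπ σ hσ hne
      have h1 := flipPairs_div_two (ext b) (π i)
      have h2 := flipPairs_div_two (ext c) (σ i)
      rw [hval i] at h1
      simp only [Set.mem_ofPred_eq] at hi
      omega
    subst hπσ
    refine Prod.ext rfl (funext fun j => ?_)
    have hj := j.2
    have h1 := hval (π.symm ⟨2 * j, by omega⟩)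
    simp only [Equiv.apply_symm_apply, flipPairs] at h1
    have h2 : 2 * (j : ℕ) / 2 = j := by omega
    simp only [h2, ext, hj, dif_pos, Fin.eta] at h1
    change b j = c j
    cases hb : b j <;> cases hc : c j <;> simp [hb, hc] at h1 ⊢
  calc S.card * 2 ^ (n / 2)
      = (S ×ˢ (Finset.univ : Finset (Fin (n / 2) → Bool))).card := by
        simp [Finset.card_product]
    _ ≤ (Finset.univ : Finset (Equiv.Perm (Fin n))).card :=
        Finset.card_le_card_of_injOn _ (fun _ _ => Finset.mem_univ _) hinj
    _ = n.factorial := by simp [Fintype.card_perm]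

/-! ### Many permutations differing by at least two -/

/-- The parity of the number of inversions of a triple. -/
def tripleParity (x y z : ℕ) : Bool := (decide (x < y) ^^ decide (y < z)) ^^ decide (x < z)

theorem tripleParity_swap_left {x y : ℕ} (z : ℕ) (h : x ≠ y) :
    tripleParity x y z ≠ tripleParity y x z := by
  unfold tripleParity
  rcases lt_or_gt_of_ne h with h | h <;>
    cases decide (y < z) <;> cases decide (x < z) <;> simp [h, h.le]

theorem tripleParity_swap_right (x : ℕ) {y z : ℕ} (h : y ≠ z) :
    tripleParity x y z ≠ tripleParity x z y := by
  unfold tripleParity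
  rcases lt_or_gt_of_ne h with h | h <;>
    cases decide (x < y) <;> cases decide (x < z) <;> simp [h, h.le]

/-- If `ρ` moves every number by at most one, then it is a product of disjoint exchanges of
neighbours. -/
theorem apply_succ_of_apply_eq_succ_s4 {ρ : Equiv.Perm ℕ} (hρ : ∀ k, ρ k ≤ k + 1 ∧ k ≤ ρ k + 1)
    (k : ℕ) (hk : ρ k = k + 1) : ρ (k + 1) = k := by
  induction k with
  | zero =>
    obtain ⟨m, hm⟩ := ρ.surjective 0
    have := hρ m
    have hm' : m = 1 := by
      have : m ≠ 0 := by rintro rfl; omega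
      omega
    rwa [hm'] at hm
  | succ k ih =>
    obtain ⟨m, hm⟩ := ρ.surjective (k + 1)
    have h1 := hρ m
    have h2 : m ≠ k + 1 := by rintro rfl; omega
    have h3 : m ≠ k := by
      rintro rfl
      have := ih hm
      omega
    have hm' : m = k + 1 + 1 := by omega
    rwa [hm'] at hm

theorem exists_tripleParity_ne {ρ : Equiv.Perm ℕ} {n : ℕ}
    (hρ : ∀ k, ρ k ≤ k + 1 ∧ k ≤ ρ k + 1) (hfix : ∀ k, n ≤ k → ρ k = k) (hne : ρ ≠ 1)
    {p : ℕ → ℕ} (hp : Function.Injective p) :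
    ∃ j < n / 2 + 1, tripleParity (p (ρ (2 * j))) (p (ρ (2 * j + 1))) (p (ρ (2 * j + 2))) ≠
      tripleParity (p (2 * j)) (p (2 * j + 1)) (p (2 * j + 2)) := by
  classical
  by_cases hev : ∃ j, ρ (2 * j) = 2 * j + 1
  · have hbound (j : ℕ) (hj : ρ (2 * j) = 2 * j + 1) : j ≤ n / 2 := by
      by_contra h
      have := hfix (2 * j) (by omega)
      omega
    obtain ⟨j₀, hj₀⟩ := hev
    let j := Nat.findGreatest (fun j => ρ (2 * j) = 2 * j + 1) (n / 2)
    have hj : ρ (2 * j) = 2 * j + 1 :=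
      Nat.findGreatest_spec (P := fun j => ρ (2 * j) = 2 * j + 1) (hbound j₀ hj₀) hj₀
    have hj1 := apply_succ_of_apply_eq_succ_s4 hρ _ hj
    have hj2 : ρ (2 * j + 2) = 2 * j + 2 := by
      have h1 := hρ (2 * j + 2)
      have h2 : ρ (2 * j + 2) ≠ 2 * j + 1 := by
        rw [← hj]
        intro h
        have := ρ.injective h
        omega
      have h3 : ρ (2 * j + 2) ≠ 2 * j + 3 := by
        intro h
        have h4 : ρ (2 * (j + 1)) = 2 * (j + 1) + 1 := h
        have := Nat.le_findGreatest (P := fun j => ρ (2 * j) = 2 * j + 1) (hbound _ h4) h4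
        change j + 1 ≤ j at this
        omega
      omega
    refine ⟨j, by have := hbound j hj; omega, ?_⟩
    rw [hj, hj1, hj2]
    exact tripleParity_swap_left _ (hp.ne (by omega))
  · push Not at hev
    have hmoved : ∃ k, ρ k ≠ k := by
      by_contra! h
      exact hne (Equiv.ext h)
    let k := Nat.find hmoved
    have hk : ρ k ≠ k := Nat.find_spec hmoved
    have hlt (m : ℕ) (hm : m < k) : ρ m = m := not_not.mp (Nat.find_min hmoved hm)
    have hk1 : ρ k = k + 1 := by
      have h1 := hρ k
      by_contra h2
      have h3 : ρ k < k := by omega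
      exact hk (ρ.injective (hlt _ h3))
    obtain ⟨j, hj⟩ : ∃ j, k = 2 * j + 1 := by
      rcases Nat.even_or_odd' k with ⟨j, hj | hj⟩
      · rw [hj] at hk1
        exact absurd hk1 (hev j)
      · exact ⟨j, hj⟩
    have hkn : k < n := by
      by_contra h
      exact hk (hfix k (by omega))
    have hk2 := apply_succ_of_apply_eq_succ_s4 hρ _ hk1
    rw [hj] at hk1 hk2
    refine ⟨j, by omega, ?_⟩
    rw [hlt (2 * j) (by omega), hk1, hk2]
    exact tripleParity_swap_right _ (hp.ne (by omega))

/-- A permutation of `Fin n`, extended to `ℕ` by fixing all `k ≥ n`. -/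
def extendNat {n : ℕ} (π : Equiv.Perm (Fin n)) : Equiv.Perm ℕ :=
  π.extendDomain Fin.equivSubtype

theorem extendNat_apply_lt {n : ℕ} (π : Equiv.Perm (Fin n)) {k : ℕ} (hk : k < n) :
    extendNat π k = π ⟨k, hk⟩ :=
  π.extendDomain_apply_subtype Fin.equivSubtype hk

theorem extendNat_apply_ge {n : ℕ} (π : Equiv.Perm (Fin n)) {k : ℕ} (hk : n ≤ k) :
    extendNat π k = k :=
  π.extendDomain_apply_not_subtype Fin.equivSubtype (by omega)

theorem extendNat_injective {n : ℕ} :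
    Function.Injective (extendNat : Equiv.Perm (Fin n) → Equiv.Perm ℕ) := by
  intro π σ h
  ext k
  rw [← extendNat_apply_lt π k.2, ← extendNat_apply_lt σ k.2, h]

/-- The colour of `π` records the inversion parities of the positions of the values
`2j, 2j + 1, 2j + 2`; permutations of the same colour differ somewhere by at least two. -/
def colour (n : ℕ) (π : Equiv.Perm (Fin n)) (j : Fin (n / 2 + 1)) : Bool :=
  tripleParity ((extendNat π).symm (2 * j)) ((extendNat π).symm (2 * j + 1))
    ((extendNat π).symm (2 * j + 2))

theorem exists_two_le_of_colour_eq {n : ℕ} {π σ : Equiv.Perm (Fin n)}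
    (h : colour n π = colour n σ) (hne : π ≠ σ) :
    ∃ i : Fin n, 2 ≤ ((π i : ℤ) - (σ i : ℤ)).natAbs := by
  by_contra! hclose
  let ρ : Equiv.Perm ℕ := extendNat σ * (extendNat π)⁻¹
  have hclose' (i : ℕ) : extendNat σ i ≤ extendNat π i + 1 ∧ extendNat π i ≤ extendNat σ i + 1 := by
    by_cases hi : i < n
    · have := hclose ⟨i, hi⟩
      rw [extendNat_apply_lt π hi, extendNat_apply_lt σ hi]
      omega
    · rw [extendNat_apply_ge π (by omega), extendNat_apply_ge σ (by omega)]
      omega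
  have hρ (k : ℕ) : ρ k ≤ k + 1 ∧ k ≤ ρ k + 1 := by
    have := hclose' ((extendNat π).symm k)
    rwa [Equiv.apply_symm_apply] at this
  have hfix (k : ℕ) (hk : n ≤ k) : ρ k = k := by
    have h1 : (extendNat π).symm k = k := by
      rw [Equiv.symm_apply_eq, extendNat_apply_ge π hk]
    change extendNat σ ((extendNat π).symm k) = k
    rw [h1, extendNat_apply_ge σ hk]
  have hρne : ρ ≠ 1 := fun h1 => hne (extendNat_injective (mul_inv_eq_one.mp h1).symm)
  obtain ⟨j, hj, hjne⟩ := exists_tripleParity_ne hρ hfix hρne (extendNat σ).symm.injective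
  have hcomp (k : ℕ) : (extendNat σ).symm (ρ k) = (extendNat π).symm k :=
    Equiv.symm_apply_apply _ _
  rw [hcomp, hcomp, hcomp] at hjne
  exact hjne (congrFun h ⟨j, hj⟩)

theorem factorial_le_T_two_mul (n : ℕ) :
    n.factorial ≤ T n {d : ℕ | 2 ≤ d} * 2 ^ (n / 2 + 1) := by
  classical
  calc n.factorial = (Finset.univ : Finset (Equiv.Perm (Fin n))).card := by
        simp [Fintype.card_perm]
    _ ≤ T n {d : ℕ | 2 ≤ d} * (Finset.univ.image (colour n)).card := by
        refine Finset.card_le_mul_card_image _ _ fun c _ => PairwiseDifferent.card_le_T ?_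
        intro π hπ σ hσ hne
        rw [Finset.mem_filter] at hπ hσ
        exact exists_two_le_of_colour_eq (hπ.2.trans hσ.2.symm) hne
    _ ≤ T n {d : ℕ | 2 ≤ d} * 2 ^ (n / 2 + 1) := by
        gcongr
        simpa using Finset.card_le_univ (Finset.univ.image (colour n))

/-! ### Many colliding permutations -/

/-- Two words collide if they have consecutive letters at a common position. -/
def collide (u v : List ℕ) : Bool :=
  (u.zip v).any fun x => x.1 + 1 == x.2 || x.2 + 1 == x.1

theorem exists_of_collide {u v : List ℕ} (h : collide u v = true) :
    ∃ i, i < u.length ∧ i < v.length ∧ ((u.getD i 0 : ℤ) - v.getD i 0).natAbs = 1 := by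
  obtain ⟨x, hx, hx'⟩ := List.any_eq_true.mp h
  obtain ⟨i, hi, rfl⟩ := List.mem_iff_getElem.mp hx
  rw [List.length_zip, lt_min_iff] at hi
  refine ⟨i, hi.1, hi.2, ?_⟩
  simp only [List.getElem_zip, Bool.or_eq_true, beq_iff_eq] at hx'
  rw [List.getD_eq_getElem _ _ hi.1, List.getD_eq_getElem _ _ hi.2]
  omega

theorem collide_comm (u v : List ℕ) : collide u v = collide v u := by
  unfold collide
  rw [← List.zip_swap u v, List.any_map]
  congr 1
  funext x
  simp [Bool.or_comm]

/-- Prefixing pairwise colliding words that are permutations of initial segments to optimal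
families on the remaining values. -/
theorem sum_T_one_le (code : List (List ℕ)) (n : ℕ) (hlen : ∀ w ∈ code, w.length ≤ n)
    (hnodup : ∀ w ∈ code, w.Nodup) (hlt : ∀ w ∈ code, ∀ x ∈ w, x < w.length)
    (hcol : code.Pairwise fun u v => collide u v = true) :
    (code.map fun w => T (n - w.length) {1}).sum ≤ T n {1} := by
  classical
  choose S hScard hS using fun m => exists_pairwiseDifferent_card_eq_T m {1}
  let ι := Σ a : Fin code.length, S (n - code[a].length)
  let f (x : ι) (k : ℕ) : ℕ :=
    if k < code[x.1].length then code[x.1].getD k 0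
    else code[x.1].length + extendNat x.2.1 (k - code[x.1].length)
  have hmem (a : Fin code.length) : code[a] ∈ code := List.getElem_mem _
  have hfst (x : ι) {k : ℕ} (hk : k < code[x.1].length) : f x k = code[x.1].getD k 0 := if_pos hk
  have hsnd (x : ι) {k : ℕ} (hk : code[x.1].length ≤ k) :
      f x k = code[x.1].length + extendNat x.2.1 (k - code[x.1].length) := if_neg hk.not_gt
  have hfst_lt (x : ι) {k : ℕ} (hk : k < code[x.1].length) : f x k < code[x.1].length := by
    rw [hfst x hk, List.getD_eq_getElem _ _ hk]
    exact hlt _ (hmem _) _ (List.getElem_mem _)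
  have hcard : Fintype.card ι = (code.map fun w => T (n - w.length) {1}).sum := by
    simp only [ι, Fintype.card_sigma, Fintype.card_coe, hScard]
    rw [← List.sum_ofFn]
    congr 1
    conv_rhs => rw [← List.ofFn_getElem (xs := code), List.map_ofFn]
    rfl
  rw [← hcard]
  refine card_le_T_one n f ?_ ?_ ?_
  · intro x k hk
    have hl := hlen _ (hmem x.1)
    by_cases hkl : k < code[x.1].length
    · exact (hfst_lt x hkl).trans_le hl
    · rw [hsnd x (by omega), extendNat_apply_lt x.2.1 (by omega)]
      omega
  · intro x k _ m _ hkm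
    by_cases hk : k < code[x.1].length <;> by_cases hm : m < code[x.1].length
    · rw [hfst x hk, hfst x hm, List.getD_eq_getElem _ _ hk, List.getD_eq_getElem _ _ hm] at hkm
      exact (hnodup _ (hmem x.1)).getElem_inj_iff.mp hkm
    · have := hfst_lt x hk
      rw [hsnd x (k := m) (by omega)] at hkm
      omega
    · have := hfst_lt x hm
      rw [hsnd x (k := k) (by omega)] at hkm
      omega
    · rw [hsnd x (by omega), hsnd x (by omega)] at hkm
      have := (extendNat x.2.1).injective (Nat.add_left_cancel hkm)
      omega
  · intro x y hxy
    by_cases hxy1 : x.1 = y.1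
    · obtain ⟨a, π⟩ := x
      obtain ⟨b, σ⟩ := y
      obtain rfl : a = b := hxy1
      have hne : π.1 ≠ σ.1 := fun h => hxy (by rw [Subtype.ext h])
      obtain ⟨i, hi⟩ := hS _ _ π.2 _ σ.2 hne
      have hi2 := i.2
      refine ⟨code[a].length + i, by omega, ?_⟩
      rw [hsnd ⟨a, π⟩ (Nat.le_add_right _ _), hsnd ⟨a, σ⟩ (Nat.le_add_right _ _),
        Nat.add_sub_cancel_left, extendNat_apply_lt _ i.2, extendNat_apply_lt _ i.2]
      simp only [Set.mem_singleton_iff] at hi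
      push_cast
      simpa using hi
    · have hc : collide code[x.1] code[y.1] = true := by
        rcases lt_or_gt_of_ne (Fin.val_ne_of_ne hxy1) with h | h
        · exact List.pairwise_iff_getElem.mp hcol _ _ x.1.2 y.1.2 h
        · rw [collide_comm]
          exact List.pairwise_iff_getElem.mp hcol _ _ y.1.2 x.1.2 h
      obtain ⟨i, hix, hiy, hi⟩ := exists_of_collide hc
      refine ⟨i, hix.trans_le (hlen _ (hmem x.1)), ?_⟩
      rwa [hfst x hix, hfst y hiy]

/-- All seven words obtained from `w` by rotating its first seven letters. -/
def rotations (w : List ℕ) : List (List ℕ) :=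
  (List.range 7).map fun s => (w.take 7).rotate s ++ w.drop 7

/-- Seventy pairwise colliding permutations of `0, …, 7`. -/
def code₈ : List (List ℕ) :=
  [[0, 2, 4, 6, 5, 3, 1, 7], [6, 0, 2, 3, 4, 7, 1, 5],
   [2, 4, 6, 5, 3, 0, 7, 1], [2, 6, 4, 7, 3, 5, 1, 0],
   [2, 0, 3, 4, 6, 1, 5, 7], [2, 6, 3, 4, 1, 0, 7, 5],
   [2, 0, 3, 4, 7, 1, 5, 6], [4, 0, 7, 5, 2, 1, 3, 6],
   [2, 6, 7, 5, 3, 4, 1, 0], [4, 1, 0, 5, 2, 7, 3, 6]].flatMap rotations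

/-- Fifty-six pairwise colliding permutations of `0, …, 8`, which also collide with the words of
`code₈`. -/
def code₉ : List (List ℕ) :=
  [[0, 8, 2, 4, 6, 5, 3, 1, 7], [0, 8, 2, 6, 3, 4, 1, 7, 5],
   [0, 2, 4, 6, 5, 3, 1, 8, 7], [6, 0, 2, 3, 4, 8, 1, 7, 5],
   [4, 0, 8, 5, 2, 1, 3, 6, 7], [2, 6, 8, 5, 3, 4, 1, 0, 7],
   [2, 0, 3, 4, 8, 1, 5, 6, 7], [2, 8, 3, 4, 1, 0, 5, 6, 7]].flatMap rotations

theorem pairwise_collide_code : (code₈ ++ code₉).Pairwise fun u v => collide u v = true := by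
  decide +kernel

theorem T_one_recurrence (n : ℕ) : 70 * T (n + 1) {1} + 56 * T n {1} ≤ T (n + 9) {1} := by
  have h8 : ∀ w ∈ code₈, w.length = 8 := by decide
  have h9 : ∀ w ∈ code₉, w.length = 9 := by decide
  have hsum := sum_T_one_le (code₈ ++ code₉) (n + 9) ?_ (by decide +kernel) (by decide +kernel)
    pairwise_collide_code
  · rw [List.map_append, List.sum_append,
      List.map_congr_left (g := fun _ => T (n + 1) {1}) fun w hw => by rw [h8 w hw]; rfl,
      List.map_congr_left (l := code₉) (g := fun _ => T n {1}) fun w hw => by rw [h9 w hw]; rfl,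
      List.map_const', List.map_const', List.sum_replicate, List.sum_replicate] at hsum
    exact hsum
  · intro w hw
    rcases List.mem_append.mp hw with h | h
    · have := h8 w h
      omega
    · have := h9 w h
      omega

theorem pow_le_T_one_mul (n : ℕ) : (1.78 : ℝ) ^ n ≤ T n {1} * 1.78 ^ 9 := by
  induction n using Nat.strong_induction_on with
  | _ n ih =>
    rcases lt_or_ge n 9 with hn | hn
    · have h1 : (1 : ℝ) ≤ T n {1} := by exact_mod_cast one_le_T n {1}
      calc (1.78 : ℝ) ^ n ≤ 1.78 ^ 9 := pow_le_pow_right₀ (by norm_num) hn.le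
        _ ≤ T n {1} * 1.78 ^ 9 := le_mul_of_one_le_left (by positivity) h1
    · obtain ⟨m, rfl⟩ := Nat.exists_eq_add_of_le' hn
      have h0 := ih m (by omega)
      have h1 := ih (m + 1) (by omega)
      have hrec : (70 * T (m + 1) {1} + 56 * T m {1} : ℝ) ≤ T (m + 9) {1} := by
        exact_mod_cast T_one_recurrence m
      calc (1.78 : ℝ) ^ (m + 9) = 1.78 ^ m * 1.78 ^ 9 := pow_add _ _ _
        _ ≤ 1.78 ^ m * (70 * 1.78 + 56) := by gcongr; norm_num
        _ = 70 * 1.78 ^ (m + 1) + 56 * 1.78 ^ m := by ring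
        _ ≤ 70 * (T (m + 1) {1} * 1.78 ^ 9) + 56 * (T m {1} * 1.78 ^ 9) := by gcongr
        _ = (70 * T (m + 1) {1} + 56 * T m {1}) * 1.78 ^ 9 := by ring
        _ ≤ T (m + 9) {1} * 1.78 ^ 9 := by gcongr

/-! ### The split strength -/

theorem logb_ratio_le (n : ℕ) :
    Real.logb 2 ((T n {1} : ℝ) * (T n {d : ℕ | 2 ≤ d} : ℝ) / (Nat.factorial n : ℝ))
      ≤ (n + 1) / 2 := by
  have hA : (1 : ℝ) ≤ T n {1} := by exact_mod_cast one_le_T n _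
  have hB : (1 : ℝ) ≤ T n {d : ℕ | 2 ≤ d} := by exact_mod_cast one_le_T n _
  have hA' : (T n {1} : ℝ) ≤ 2 ^ n := by exact_mod_cast T_one_le n
  have hB' : (T n {d : ℕ | 2 ≤ d} : ℝ) * 2 ^ (n / 2) ≤ n.factorial := by
    exact_mod_cast T_two_le_mul n
  have hf : (0 : ℝ) < n.factorial := by positivity
  have hle : (T n {1} : ℝ) * (T n {d : ℕ | 2 ≤ d} : ℝ) / (Nat.factorial n : ℝ)
      ≤ 2 ^ (n - n / 2) := by
    rw [div_le_iff₀ hf]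
    calc (T n {1} : ℝ) * (T n {d : ℕ | 2 ≤ d} : ℝ)
        ≤ 2 ^ n * (T n {d : ℕ | 2 ≤ d} : ℝ) := by gcongr
      _ = 2 ^ (n - n / 2) * ((T n {d : ℕ | 2 ≤ d} : ℝ) * 2 ^ (n / 2)) := by
          rw [mul_comm (T n _ : ℝ), ← mul_assoc, ← pow_add, Nat.sub_add_cancel (Nat.div_le_self n 2)]
      _ ≤ 2 ^ (n - n / 2) * n.factorial := by gcongr
  calc _ ≤ Real.logb 2 (2 ^ (n - n / 2)) :=
        Real.logb_le_logb_of_le (by norm_num) (by positivity) hle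
    _ = ((n - n / 2 : ℕ) : ℝ) := by rw [Real.logb_pow, Real.logb_self_eq_one (by norm_num), mul_one]
    _ ≤ (n + 1) / 2 := by
        rw [le_div_iff₀ (by norm_num)]
        have : (n - n / 2) * 2 ≤ n + 1 := by omega
        exact_mod_cast this

theorem le_logb_ratio (n : ℕ) :
    0.331 * n - 10 ≤
      Real.logb 2 ((T n {1} : ℝ) * (T n {d : ℕ | 2 ≤ d} : ℝ) / (Nat.factorial n : ℝ)) := by
  have hA : (1 : ℝ) ≤ T n {1} := by exact_mod_cast one_le_T n _
  have hf : (0 : ℝ) < n.factorial := by positivity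
  have hA' := pow_le_T_one_mul n
  have hB' : (n.factorial : ℝ) ≤ T n {d : ℕ | 2 ≤ d} * 2 ^ (n / 2 + 1) := by
    exact_mod_cast factorial_le_T_two_mul n
  have hle : (1.78 : ℝ) ^ n / (1.78 ^ 9 * 2 ^ (n / 2 + 1)) ≤
      (T n {1} : ℝ) * (T n {d : ℕ | 2 ≤ d} : ℝ) / (Nat.factorial n : ℝ) := by
    rw [div_le_div_iff₀ (by positivity) hf]
    calc (1.78 : ℝ) ^ n * n.factorial
        ≤ (T n {1} * 1.78 ^ 9) * (T n {d : ℕ | 2 ≤ d} * 2 ^ (n / 2 + 1)) := by gcongr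
      _ = _ := by ring
  have hlog_lower : (0.831 : ℝ) ≤ Real.logb 2 1.78 := by
    have h : Real.logb 2 (2 ^ 64) ≤ Real.logb 2 (1.78 ^ 77) :=
      Real.logb_le_logb_of_le (by norm_num) (by positivity) (by norm_num)
    rw [Real.logb_pow, Real.logb_pow, Real.logb_self_eq_one (by norm_num)] at h
    push_cast at h
    linarith
  have hlog_upper : Real.logb 2 1.78 ≤ 0.9 := by
    have h : Real.logb 2 (1.78 ^ 10) ≤ Real.logb 2 (2 ^ 9) :=
      Real.logb_le_logb_of_le (by norm_num) (by positivity) (by norm_num)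
    rw [Real.logb_pow, Real.logb_pow, Real.logb_self_eq_one (by norm_num)] at h
    push_cast at h
    linarith
  refine le_trans ?_ (Real.logb_le_logb_of_le (by norm_num) (by positivity) hle)
  rw [Real.logb_div (by positivity) (by positivity), Real.logb_mul (by positivity) (by positivity),
    Real.logb_pow, Real.logb_pow, Real.logb_pow, Real.logb_self_eq_one (by norm_num)]
  have hhalf : ((n / 2 + 1 : ℕ) : ℝ) ≤ n / 2 + 1 := by
    push_cast
    gcongr
    exact Nat.cast_div_le
  have hn : (0 : ℝ) ≤ n := Nat.cast_nonneg n
  push_cast at hhalf ⊢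
  nlinarith

/-- Proposition: `0.33 < φ({1}, complement of {1}) ≤ 1/2`. -/
theorem splitStrength_one :
    0.33 < splitStrength {1} {d : ℕ | 2 ≤ d} ∧
    splitStrength {1} {d : ℕ | 2 ≤ d} ≤ 1 / 2 := by
  set u : ℕ → ℝ := fun n =>
    Real.logb 2 ((T n {1} : ℝ) * (T n {d : ℕ | 2 ≤ d} : ℝ) / (Nat.factorial n : ℝ)) / n with hu
  have hlow : ∀ᶠ n in atTop, 0.3305 ≤ u n := by
    filter_upwards [eventually_ge_atTop 20000] with n hn
    have hn' : (20000 : ℝ) ≤ n := by exact_mod_cast hn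
    rw [hu, le_div_iff₀ (by linarith)]
    linarith [le_logb_ratio n]
  have hup : ∀ᶠ n : ℕ in atTop, u n ≤ 1 / 2 + 1 / n := by
    filter_upwards [eventually_ge_atTop 1] with n hn
    have hn' : (1 : ℝ) ≤ n := by exact_mod_cast hn
    rw [hu, div_le_iff₀ (by linarith), add_mul, one_div_mul_cancel (by linarith)]
    linarith [logb_ratio_le n]
  have hlim : Tendsto (fun n : ℕ => (1 / 2 + 1 / n : ℝ)) atTop (nhds (1 / 2)) := by
    simpa using tendsto_const_nhds.add (tendsto_one_div_atTop_nhds_zero_nat (𝕜 := ℝ))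
  have hbdd : IsBoundedUnder (· ≤ ·) atTop u := hlim.isBoundedUnder_le.mono_le hup
  have hcobdd : IsCoboundedUnder (· ≤ ·) atTop u :=
    IsBoundedUnder.isCoboundedUnder_le ⟨0.3305, eventually_map.mpr hlow⟩
  change 0.33 < limsup u atTop ∧ limsup u atTop ≤ 1 / 2
  constructor
  · calc (0.33 : ℝ) < 0.3305 := by norm_num
      _ ≤ limsup u atTop := le_limsup_of_frequently_le hlow.frequently hbdd
  · calc limsup u atTop ≤ limsup (fun n : ℕ => (1 / 2 + 1 / n : ℝ)) atTop :=
          limsup_le_limsup hup hcobdd hlim.isBoundedUnder_le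
      _ = 1 / 2 := hlim.limsup_eq
end

section
/- For every natural number n ≥ 1, T(n, O) = C(n, ⌊n/2⌋) (the binomial coefficient n choose ⌊n/2⌋), where O = {1,3,5,…} is the set of odd positive integers. -/
theorem Fin.card_filter_even (n : ℕ) :
    (Finset.univ.filter fun i : Fin n => Even (i : ℕ)).card = (n + 1) / 2 := by
  rw [Finset.card_filter, Fin.sum_univ_eq_sum_range (fun i => if Even i then 1 else 0) n]
  induction n with
  | zero => rfl
  | succ k ih =>
    rw [Finset.sum_range_succ, ih]
    split_ifs with h <;> rw [Nat.even_iff] at h <;> omega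

theorem Nat.choose_succ_half (n : ℕ) : n.choose ((n + 1) / 2) = n.choose (n / 2) :=
  Nat.choose_symm_of_eq_add (by omega)

theorem odd_natAbs_sub_iff (a b : ℕ) :
    Odd ((a : ℤ) - (b : ℤ)).natAbs ↔ ¬(Even a ↔ Even b) := by
  rw [Int.natAbs_odd, ← Int.not_even_iff_odd, Int.even_sub, Int.even_coe_nat, Int.even_coe_nat]

/-- The positions at which a permutation takes an even value. -/
def evenPositions {n : ℕ} (π : Equiv.Perm (Fin n)) : Finset (Fin n) :=
  Finset.univ.filter fun i => Even (π i : ℕ)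

theorem mem_evenPositions {n : ℕ} {π : Equiv.Perm (Fin n)} {i : Fin n} :
    i ∈ evenPositions π ↔ Even (π i : ℕ) := by
  simp [evenPositions]

theorem card_evenPositions {n : ℕ} (π : Equiv.Perm (Fin n)) :
    (evenPositions π).card = (n + 1) / 2 := by
  rw [← Fin.card_filter_even n]
  exact Finset.card_equiv π (by simp [evenPositions])

theorem exists_odd_natAbs_sub_iff {n : ℕ} (π σ : Equiv.Perm (Fin n)) :
    (∃ i : Fin n, Odd ((π i : ℤ) - (σ i : ℤ)).natAbs) ↔ evenPositions π ≠ evenPositions σ := by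
  simp only [ne_eq, Finset.ext_iff, mem_evenPositions, not_forall]
  exact exists_congr fun i => odd_natAbs_sub_iff (π i) (σ i)

theorem exists_evenPositions_eq {n : ℕ} {A : Finset (Fin n)} (hA : A.card = (n + 1) / 2) :
    ∃ π : Equiv.Perm (Fin n), evenPositions π = A := by
  have e : {i // i ∈ A} ≃ {i // i ∈ Finset.univ.filter fun i : Fin n => Even (i : ℕ)} :=
    Finset.equivOfCardEq (hA.trans (Fin.card_filter_even n).symm)
  refine ⟨e.extendSubtype, Finset.ext fun i => ?_⟩
  rw [mem_evenPositions]
  by_cases hi : i ∈ A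
  · simpa [hi] using e.extendSubtype_mem i hi
  · simpa [hi] using e.extendSubtype_not_mem i hi

/-- `T(n, O) = binom(n, ⌊n/2⌋)` where `O` is the set of odd positive integers. -/
theorem T_odd (n : ℕ) (hn : 1 ≤ n) :
    T n {d : ℕ | Odd d} = Nat.choose n (n / 2) := by
  have hcard : (Finset.powersetCard ((n + 1) / 2) (Finset.univ : Finset (Fin n))).card
      = n.choose (n / 2) := by
    rw [Finset.card_powersetCard, Finset.card_univ, Fintype.card_fin, Nat.choose_succ_half]
  simp only [T, Set.mem_ofPred_eq, exists_odd_natAbs_sub_iff]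
  refine IsGreatest.csSup_eq ⟨?_, ?_⟩
  · have hsurj : Set.SurjOn (evenPositions (n := n)) Set.univ
        (Finset.powersetCard ((n + 1) / 2) (Finset.univ : Finset (Fin n)) : Set (Finset (Fin n))) := by
      intro A hA
      obtain ⟨π, hπ⟩ := exists_evenPositions_eq (Finset.mem_powersetCard.1 hA).2
      exact ⟨π, trivial, hπ⟩
    obtain ⟨S, -, hinj, himage⟩ := Finset.exists_subset_injOn_image_eq_of_surjOn _ _ hsurj
    refine ⟨S, ?_, fun π hπ σ hσ hne heq => hne (hinj hπ hσ heq)⟩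
    rw [← hcard, ← himage, Finset.card_image_of_injOn hinj]
  · rintro _ ⟨S, rfl, hS⟩
    rw [← hcard]
    refine Finset.card_le_card_of_injOn evenPositions (fun π _ => ?_) fun π hπ σ hσ heq => ?_
    · exact Finset.mem_powersetCard.2 ⟨Finset.subset_univ _, card_evenPositions π⟩
    · by_contra hne
      exact hS π hπ σ hσ hne heq
end

section
/- For every natural number n ≥ 1, the quantity T(n, 2ℕ), where 2ℕ = {2,4,6,…} is the set of even positive integers, satisfies n! · (⌈n/2⌉ + 1) / ( 2 · C(n, ⌊n/2⌋) ) ≤ T(n, 2ℕ) ≤ n! / 2^⌊n/2⌋, where C(n, ⌊n/2⌋) is the binomial coefficient. -/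
theorem bddAbove_card_pairwise_different (n : ℕ) (D : Set ℕ) :
    BddAbove {k | ∃ S : Finset (Equiv.Perm (Fin n)), S.card = k ∧
      ∀ π ∈ S, ∀ σ ∈ S, π ≠ σ →
        ∃ i : Fin n, ((π i : ℤ) - (σ i : ℤ)).natAbs ∈ D} := by
  refine ⟨Fintype.card (Equiv.Perm (Fin n)), ?_⟩
  rintro k ⟨S, rfl, -⟩
  exact Finset.card_le_univ S

/-- A family of permutations whose distinct indices give `G(D)`-different permutations bounds
`T n D` from below, provided `0 ∉ D`. -/
theorem card_le_T {ι : Type*} [Fintype ι] {n : ℕ} {D : Set ℕ} (hD : 0 ∉ D)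
    (p : ι → Equiv.Perm (Fin n))
    (hp : ∀ a b, a ≠ b → ∃ i, ((p a i : ℤ) - (p b i : ℤ)).natAbs ∈ D) :
    Fintype.card ι ≤ T n D := by
  have hinj : Function.Injective p := by
    intro a b hab
    by_contra hne
    obtain ⟨i, hi⟩ := hp a b hne
    simp [hab, hD] at hi
  refine le_csSup (bddAbove_card_pairwise_different n D)
    ⟨Finset.univ.map ⟨p, hinj⟩, by simp, ?_⟩
  intro π hπ σ hσ hne
  simp only [Finset.mem_map, Finset.mem_univ, true_and, Function.Embedding.coeFn_mk] at hπ hσ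
  obtain ⟨a, rfl⟩ := hπ
  obtain ⟨b, rfl⟩ := hσ
  exact hp a b fun h => hne (congrArg p h)

/-- Exchange the values `2 * j` and `2 * j + 1` for every `j < n / 2` selected by `f`. -/
def flipFun {n : ℕ} (f : Fin (n / 2) → Bool) (v : Fin n) : Fin n :=
  if h : v.val / 2 < n / 2 then
    if f ⟨v.val / 2, h⟩ then
      if h₀ : v.val % 2 = 0 then ⟨v.val + 1, by omega⟩ else ⟨v.val - 1, by omega⟩
    else v
  else v

theorem flipFun_div_two {n : ℕ} (f : Fin (n / 2) → Bool) (v : Fin n) :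
    (flipFun f v).val / 2 = v.val / 2 := by
  unfold flipFun
  split_ifs <;> simp only <;> omega

theorem flipFun_involutive {n : ℕ} (f : Fin (n / 2) → Bool) :
    Function.Involutive (flipFun f) := by
  intro v
  have hdiv := flipFun_div_two f v
  by_cases h : v.val / 2 < n / 2
  · by_cases hf : f ⟨v.val / 2, h⟩ = true
    · have hval : (flipFun f v).val = if v.val % 2 = 0 then v.val + 1 else v.val - 1 := by
        simp only [flipFun, h, hf, dite_true, if_true]
        split_ifs <;> rfl
      generalize flipFun f v = w at hdiv hval
      apply Fin.ext
      simp only [flipFun, hdiv, h, hf, dite_true, if_true]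
      split_ifs at hval ⊢ <;> simp only <;> omega
    · simp [flipFun, h, hf]
  · simp [flipFun, h]

theorem flipFun_injective {n : ℕ} :
    Function.Injective (flipFun : (Fin (n / 2) → Bool) → Fin n → Fin n) := by
  intro f g hfg
  funext j
  have hj := j.isLt
  have h := congrArg Fin.val (congrFun hfg ⟨2 * j.val, by omega⟩)
  have hdiv : 2 * j.val / 2 = j.val := by omega
  simp only [flipFun, hdiv, hj, dite_true, Fin.eta] at h
  cases hf : f j <;> cases hg : g j <;> simp [hf, hg] at h ⊢

theorem T_even_le (n : ℕ) :
    T n {d : ℕ | 0 < d ∧ Even d} ≤ Nat.factorial n / 2 ^ (n / 2) := by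
  refine csSup_le' ?_
  rintro k ⟨S, rfl, hS⟩
  rw [Nat.le_div_iff_mul_le (by positivity)]
  let F : S × (Fin (n / 2) → Bool) → Equiv.Perm (Fin n) :=
    fun x => x.1.val.trans (flipFun_involutive x.2).toPerm
  have hF : Function.Injective F := by
    rintro ⟨⟨π, hπ⟩, f⟩ ⟨⟨σ, hσ⟩, g⟩ h
    have happ : ∀ i, flipFun f (π i) = flipFun g (σ i) := fun i => congrArg (· i) h
    have hπσ : π = σ := by
      by_contra hne
      obtain ⟨i, hpos, c, hc⟩ := hS π hπ σ hσ hne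
      have h₁ := flipFun_div_two f (π i)
      have h₂ := flipFun_div_two g (σ i)
      rw [happ i] at h₁
      omega
    subst hπσ
    have hfg : f = g := by
      apply flipFun_injective
      funext v
      simpa using happ (π.symm v)
    rw [hfg]
  simpa [Fintype.card_perm] using Fintype.card_le_of_injective F hF

theorem card_even_fin (n : ℕ) : Fintype.card {v : Fin n // v.val % 2 = 0} = (n + 1) / 2 := by
  rw [Fintype.card_subtype, Finset.card_filter,
    Fin.sum_univ_eq_sum_range (fun i => if i % 2 = 0 then 1 else 0)]
  induction n with
  | zero => rfl
  | succ n ih =>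
    rw [Finset.sum_range_succ, ih]
    split_ifs <;> omega

theorem card_odd_fin (n : ℕ) : Fintype.card {v : Fin n // v.val % 2 = 1} = n / 2 := by
  rw [Fintype.card_subtype, Finset.card_filter,
    Fin.sum_univ_eq_sum_range (fun i => if i % 2 = 1 then 1 else 0)]
  induction n with
  | zero => rfl
  | succ n ih =>
    rw [Finset.sum_range_succ, ih]
    split_ifs <;> omega

theorem card_even_or_eq_one_fin {n : ℕ} (hn : 2 ≤ n) :
    Fintype.card {v : Fin n // v.val % 2 = 0 ∨ v.val = 1} = (n + 1) / 2 + 1 := by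
  rw [Fintype.card_subtype_or_disjoint, card_even_fin]
  · congr 1
    rw [Fintype.card_eq_one_iff]
    exact ⟨⟨⟨1, by omega⟩, rfl⟩, fun v => Subtype.ext (Fin.ext v.2)⟩
  · rw [Pi.disjoint_iff]
    intro v
    rw [Prop.disjoint_iff]
    omega

/-- Distinct permutations of equal sign take distinct values, both different from `z`,
at some common point. -/
theorem exists_ne_of_sign_eq {α : Type*} [Fintype α] [DecidableEq α] {τ τ' : Equiv.Perm α}
    (hsign : Equiv.Perm.sign τ = Equiv.Perm.sign τ') (hne : τ ≠ τ') (z : α) :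
    ∃ i, τ i ≠ τ' i ∧ τ i ≠ z ∧ τ' i ≠ z := by
  by_contra! hcon
  set ρ := τ⁻¹ * τ' with hρ
  have hρ1 : ρ ≠ 1 := fun h => hne (inv_mul_eq_one.mp h)
  have hsub : ρ.support ⊆ {τ.symm z, τ'.symm z} := by
    intro i hi
    have hi' : τ i ≠ τ' i := by
      intro h
      apply Equiv.Perm.mem_support.mp hi
      simp [hρ, ← h]
    simp only [Finset.mem_insert, Finset.mem_singleton, Equiv.eq_symm_apply]
    by_contra! h
    exact h.2 (hcon i hi' h.1)
  have hcard : ρ.support.card = 2 :=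
    le_antisymm ((Finset.card_le_card hsub).trans Finset.card_le_two)
      (Equiv.Perm.two_le_card_support_of_ne_one hρ1)
  have hs := (Equiv.Perm.card_support_eq_two.mp hcard).sign_eq
  simp [hρ, hsign] at hs

theorem le_T_even {n : ℕ} (hn : 2 ≤ n) :
    ((n + 1) / 2 + 1).factorial * (n / 2).factorial ≤
      2 * T n {d : ℕ | 0 < d ∧ Even d} := by
  let Z := {v : Fin n // v.val % 2 = 0 ∨ v.val = 1}
  let Y := {v : Fin n // v.val % 2 = 1}
  let p : alternatingGroup Z × Equiv.Perm Y → Equiv.Perm (Fin n) :=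
    fun x => Equiv.Perm.ofSubtype x.2 * Equiv.Perm.ofSubtype x.1.val
  have hp : ∀ a b, a ≠ b →
      ∃ i, ((p a i : ℤ) - (p b i : ℤ)).natAbs ∈ {d : ℕ | 0 < d ∧ Even d} := by
    suffices h : ∀ a b, a ≠ b →
        ∃ i, p a i ≠ p b i ∧ (p a i).val % 2 = (p b i).val % 2 by
      intro a b hab
      obtain ⟨i, hi, hmod⟩ := h a b hab
      have hi' : (p a i).val ≠ (p b i).val := fun h => hi (Fin.ext h)
      refine ⟨i, ?_, ?_⟩
      · omega
      · rw [Nat.even_iff]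
        omega
    rintro ⟨⟨τ, hτ⟩, β⟩ ⟨⟨τ', hτ'⟩, β'⟩ hne
    by_cases h : τ = τ'
    · subst h
      have hβ : β ≠ β' := fun h => hne (by rw [h])
      obtain ⟨y, hy⟩ := DFunLike.ne_iff.mp hβ
      refine ⟨(Equiv.Perm.ofSubtype τ).symm y, ?_⟩
      simp only [p, Equiv.Perm.mul_apply, Equiv.apply_symm_apply,
        Equiv.Perm.ofSubtype_apply_coe]
      exact ⟨fun h => hy (Subtype.ext h), (β y).2.trans (β' y).2.symm⟩
    · rw [Equiv.Perm.mem_alternatingGroup] at hτ hτ'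
      obtain ⟨i, hi, hz, hz'⟩ :=
        exists_ne_of_sign_eq (hτ.trans hτ'.symm) h (⟨⟨1, by omega⟩, Or.inr rfl⟩ : Z)
      have heven : ∀ w : Z, w ≠ ⟨⟨1, by omega⟩, Or.inr rfl⟩ → w.val.val % 2 = 0 := by
        intro w hw
        exact w.2.resolve_right fun h => hw (Subtype.ext (Fin.ext h))
      have hfix : ∀ (γ : Equiv.Perm Y) (w : Fin n), w.val % 2 = 0 →
          Equiv.Perm.ofSubtype γ w = w := fun γ w hw =>
        Equiv.Perm.ofSubtype_apply_of_not_mem γ (by omega)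
      refine ⟨i, ?_⟩
      simp only [p, Equiv.Perm.mul_apply, Equiv.Perm.ofSubtype_apply_coe]
      rw [hfix β _ (heven _ hz), hfix β' _ (heven _ hz')]
      exact ⟨fun h => hi (Subtype.ext h), (heven _ hz).trans (heven _ hz').symm⟩
  have hcard := card_le_T (by simp) p hp
  have hZ : Fintype.card Z = (n + 1) / 2 + 1 := card_even_or_eq_one_fin hn
  have hY : Fintype.card Y = n / 2 := card_odd_fin n
  have : Nontrivial Z := Fintype.one_lt_card_iff_nontrivial.mp (by omega)
  have halt := two_mul_card_alternatingGroup (α := Z)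
  rw [Fintype.card_perm, hZ] at halt
  rw [Fintype.card_prod, Fintype.card_perm, hY] at hcard
  rw [← halt, mul_assoc]
  exact Nat.mul_le_mul_left 2 hcard

/-- Proposition: bounds on `T(n, 2ℕ)` where `2ℕ` is the set of even positive
integers.  Here `⌈n/2⌉ = (n+1)/2` in natural number arithmetic. -/
theorem T_even_bounds (n : ℕ) (hn : 1 ≤ n) :
    Nat.factorial n * ((n + 1) / 2 + 1) / (2 * Nat.choose n (n / 2)) ≤
      T n {d : ℕ | 0 < d ∧ Even d} ∧
    T n {d : ℕ | 0 < d ∧ Even d} ≤ Nat.factorial n / 2 ^ (n / 2) := by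
  refine ⟨?_, T_even_le n⟩
  obtain rfl | hn2 := hn.eq_or_lt
  · simpa using card_le_T (ι := Unit) (D := {d : ℕ | 0 < d ∧ Even d}) (by simp)
      (fun _ => (1 : Equiv.Perm (Fin 1))) (fun a b hab => (hab rfl).elim)
  · apply Nat.div_le_of_le_mul
    have hsub : n - n / 2 = (n + 1) / 2 := by omega
    have hchoose := Nat.choose_mul_factorial_mul_factorial (Nat.div_le_self n 2)
    rw [hsub] at hchoose
    calc n.factorial * ((n + 1) / 2 + 1)
        = n.choose (n / 2) * (((n + 1) / 2 + 1).factorial * (n / 2).factorial) := by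
          rw [← hchoose, Nat.factorial_succ]
          ring
      _ ≤ n.choose (n / 2) * (2 * T n {d : ℕ | 0 < d ∧ Even d}) :=
          Nat.mul_le_mul_left _ (le_T_even hn2)
      _ = 2 * n.choose (n / 2) * T n {d : ℕ | 0 < d ∧ Even d} := by ring
end

section
/- For every positive integer q and every natural number n ≥ 1, T(n, {q}) ≤ T(n, {1}). -/
/-- Listing the residue classes modulo `q` one after the other gives a permutation of `Fin n`
that sends any two elements differing by `q` to consecutive elements. -/
theorem exists_perm_natAbs_sub_eq_one (n q : ℕ) (hq : 1 ≤ q) :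
    ∃ f : Equiv.Perm (Fin n), ∀ a b : Fin n,
      ((a : ℤ) - (b : ℤ)).natAbs = q → ((f a : ℤ) - (f b : ℤ)).natAbs = 1 := by
  classical
  let key : Fin n → ℕ ×ₗ ℕ := fun x => toLex ((x : ℕ) % q, (x : ℕ))
  have key_inj : Function.Injective key := fun x y h =>
    Fin.ext (congrArg Prod.snd (congrArg ofLex h))
  let below : Fin n → Finset (Fin n) := fun x => Finset.univ.filter fun y => key y < key x
  have card_lt : ∀ x, (below x).card < n := fun x => by
    have h : below x ⊂ Finset.univ :=
      Finset.ssubset_univ_iff.2 fun h => by simpa [below] using h.ge (Finset.mem_univ x)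
    simpa using Finset.card_lt_card h
  let rank : Fin n → Fin n := fun x => ⟨(below x).card, card_lt x⟩
  have rank_lt : ∀ x y, key x < key y → rank x < rank y := fun x y h => by
    change (below x).card < (below y).card
    refine Finset.card_lt_card ((Finset.ssubset_iff_of_subset fun z hz => ?_).2 ⟨x, ?_, ?_⟩)
    · simp only [below, Finset.mem_filter_univ] at hz ⊢
      exact hz.trans h
    · simpa [below] using h
    · simp [below]
  have rank_inj : Function.Injective rank := fun x y h => by
    by_contra hxy
    rcases lt_or_gt_of_ne (key_inj.ne hxy) with hlt | hlt
    · exact (rank_lt x y hlt).ne h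
    · exact (rank_lt y x hlt).ne' h
  have rank_add : ∀ a b : Fin n, (b : ℕ) = a + q → (rank b : ℕ) = rank a + 1 := by
    intro a b hab
    have hmod : (b : ℕ) % q = a % q := by simp [hab]
    have hbelow : below b = insert a (below a) := by
      ext y
      simp only [below, key, Finset.mem_filter_univ, Finset.mem_insert, Prod.Lex.toLex_lt_toLex,
        hmod, Fin.ext_iff]
      constructor
      · rintro (h | ⟨h, hlt⟩)
        · exact Or.inr (Or.inl h)
        · rcases lt_or_ge (y : ℕ) a with hya | hya
          · exact Or.inr (Or.inr ⟨h, hya⟩)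
          · obtain ⟨k, hk⟩ := (Nat.modEq_iff_dvd' hya).1 h.symm
            have hk0 : k = 0 := by
              by_contra hk0
              have := Nat.le_mul_of_pos_right q (Nat.pos_of_ne_zero hk0)
              omega
            subst hk0
            omega
      · rintro (h | h | ⟨h, hlt⟩)
        · exact Or.inr ⟨by rw [h], by omega⟩
        · exact Or.inl h
        · exact Or.inr ⟨h, by omega⟩
    have ha : a ∉ below a := by simp [below]
    simp only [rank, hbelow, Finset.card_insert_of_notMem ha]
  refine ⟨Equiv.ofBijective rank (Finite.injective_iff_bijective.1 rank_inj), fun a b h => ?_⟩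
  simp only [Equiv.ofBijective_apply]
  rcases le_total (a : ℕ) b with hab | hab
  · have := rank_add a b (by omega)
    omega
  · have := rank_add b a (by omega)
    omega

/-- For every `q ≥ 1` and `n ≥ 1`, `T(n, {q}) ≤ T(n, {1})`. -/
theorem T_singleton_le (q n : ℕ) (hq : 1 ≤ q) (hn : 1 ≤ n) :
    T n {q} ≤ T n {1} := by
  obtain ⟨f, hf⟩ := exists_perm_natAbs_sub_eq_one n q hq
  refine csSup_le_csSup ⟨Fintype.card (Equiv.Perm (Fin n)), ?_⟩ ⟨0, ∅, by simp⟩ ?_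
  · rintro _ ⟨S, rfl, -⟩
    exact S.card_le_univ
  · rintro _ ⟨S, rfl, hS⟩
    refine ⟨S.map (mulLeftEmbedding f), S.card_map _, ?_⟩
    simp only [Finset.mem_map, mulLeftEmbedding_apply]
    rintro _ ⟨π, hπ, rfl⟩ _ ⟨σ, hσ, rfl⟩ hne
    obtain ⟨i, hi⟩ := hS π hπ σ hσ fun h => hne (by rw [h])
    exact ⟨i, hf (π i) (σ i) hi⟩
end

section
/- Let E = {m ∈ ℕ⁺ : ex(m) is even}, where ex(m) denotes the exponent of 2 in the prime factorization of m (the 2-adic valuation). If n = 4^t for some natural number t, then ( (√n)! )^{√n} ≤ T(n, E) ≤ n! / ( (√n)! )^{√n}, where √n = 2^t. -/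
/-- The set `E` of positive integers whose 2-adic valuation is even. -/
def Eset : Set ℕ := {m : ℕ | 0 < m ∧ Even (padicValNat 2 m)}

theorem mem_Eset_of_mod_two_eq_one {m : ℕ} (h : m % 2 = 1) : m ∈ Eset := by
  refine ⟨by omega, ?_⟩
  rw [padicValNat.eq_zero_of_not_dvd (by omega)]
  exact Even.zero

theorem notMem_Eset_of_mod_four_eq_two {m : ℕ} (h : m % 4 = 2) : m ∉ Eset := by
  rintro ⟨-, he⟩
  obtain ⟨k, rfl⟩ : ∃ k, m = 2 * k := ⟨m / 2, by omega⟩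
  rw [padicValNat.mul (by omega) (by omega), padicValNat_self,
    padicValNat.eq_zero_of_not_dvd (n := k) (by omega)] at he
  exact absurd he (by decide)

theorem four_mul_mem_Eset_iff {m : ℕ} : 4 * m ∈ Eset ↔ m ∈ Eset := by
  rcases Nat.eq_zero_or_pos m with rfl | hm
  · simp
  · have h : padicValNat 2 (4 * m) = padicValNat 2 m + 2 := by
      rw [show 4 * m = 2 * (2 * m) by ring, padicValNat.mul (by omega) (by omega),
        padicValNat.mul (by omega) (by omega), padicValNat_self]
      ring
    have hm' : 0 < 4 * m := by omega
    simp [Eset, h, hm, Nat.even_add]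

/-- The number formed by the first `t` binary digits of `x` at even positions. -/
def evenBits : ℕ → ℕ → ℕ
  | 0, _ => 0
  | t + 1, x => x % 2 + 2 * evenBits t (x / 4)

theorem evenBits_lt (t x : ℕ) : evenBits t x < 2 ^ t := by
  induction t generalizing x with
  | zero => simp [evenBits]
  | succ t ih =>
    have := ih (x / 4)
    rw [evenBits, pow_succ]
    omega

theorem natAbs_sub_notMem_Eset {t x y : ℕ} (hx : x < 4 ^ t) (hy : y < 4 ^ t)
    (h : evenBits t x = evenBits t y) : ((x : ℤ) - y).natAbs ∉ Eset := by
  induction t generalizing x y with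
  | zero =>
    obtain rfl : x = y := by simp at hx hy; omega
    simp [Eset]
  | succ t ih =>
    simp only [evenBits] at h
    rw [pow_succ] at hx hy
    by_cases h4 : x % 4 = y % 4
    · rw [show ((x : ℤ) - y).natAbs = 4 * (((x / 4 : ℕ) : ℤ) - (y / 4 : ℕ)).natAbs by omega,
        four_mul_mem_Eset_iff]
      exact ih (by omega) (by omega) (by omega)
    · exact notMem_Eset_of_mod_four_eq_two (by omega)

theorem natAbs_sub_mem_Eset {t x y : ℕ} (hx : x < 4 ^ t) (hy : y < 4 ^ t) (hne : x ≠ y)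
    (h : evenBits t (x / 2) = evenBits t (y / 2)) : ((x : ℤ) - y).natAbs ∈ Eset := by
  induction t generalizing x y with
  | zero => simp at hx hy; omega
  | succ t ih =>
    simp only [evenBits] at h
    rw [pow_succ] at hx hy
    rw [Nat.div_right_comm x, Nat.div_right_comm y] at h
    by_cases h2 : x % 2 = y % 2
    · rw [show ((x : ℤ) - y).natAbs = 4 * (((x / 4 : ℕ) : ℤ) - (y / 4 : ℕ)).natAbs by omega,
        four_mul_mem_Eset_iff]
      exact ih (by omega) (by omega) (by omega) (by omega)
    · exact mem_Eset_of_mod_two_eq_one (by omega)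

/-- The class of `x` given by its binary digits at even positions. -/
def evenClass (t : ℕ) (x : Fin (4 ^ t)) : Fin (2 ^ t) :=
  ⟨evenBits t x, evenBits_lt t x⟩

/-- The class of `x` given by its binary digits at odd positions. -/
def oddClass (t : ℕ) (x : Fin (4 ^ t)) : Fin (2 ^ t) :=
  ⟨evenBits t (x / 2), evenBits_lt t _⟩

theorem bijective_evenClass_oddClass (t : ℕ) :
    Function.Bijective fun x ↦ (evenClass t x, oddClass t x) := by
  rw [Fintype.bijective_iff_injective_and_card]
  constructor
  · intro x y h
    simp only [evenClass, oddClass, Prod.mk.injEq, Fin.mk.injEq] at h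
    by_contra hne
    exact natAbs_sub_notMem_Eset x.2 y.2 h.1
      (natAbs_sub_mem_Eset x.2 y.2 (Fin.val_ne_of_ne hne) h.2)
  · simp [← mul_pow]

theorem card_evenClass_fiber (t : ℕ) (i : Fin (2 ^ t)) :
    Fintype.card {x // evenClass t x = i} = 2 ^ t := by
  let e := Equiv.ofBijective _ (bijective_evenClass_oddClass t)
  have e' : {x // evenClass t x = i} ≃ {p : Fin (2 ^ t) × Fin (2 ^ t) // p.1 = i} :=
    e.subtypeEquiv fun _ ↦ Iff.rfl
  rw [Fintype.card_congr (e'.trans (Equiv.prodSubtypeFstEquivSubtypeProd (p := (· = i))))]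
  simp

theorem card_oddClass_fiber (t : ℕ) (i : Fin (2 ^ t)) :
    Fintype.card {x // oddClass t x = i} = 2 ^ t := by
  let e := (Equiv.ofBijective _ (bijective_evenClass_oddClass t)).trans (Equiv.prodComm _ _)
  have e' : {x // oddClass t x = i} ≃ {p : Fin (2 ^ t) × Fin (2 ^ t) // p.1 = i} :=
    e.subtypeEquiv fun _ ↦ Iff.rfl
  rw [Fintype.card_congr (e'.trans (Equiv.prodSubtypeFstEquivSubtypeProd (p := (· = i))))]
  simp

theorem card_perm_preserving {α ι : Type*} [Fintype α] [DecidableEq α] [Fintype ι]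
    [DecidableEq ι] (c : α → ι) {k : ℕ} (hc : ∀ i, Fintype.card {x // c x = i} = k) :
    (Finset.univ.filter fun g : Equiv.Perm α ↦ c ∘ g = c).card
      = k.factorial ^ Fintype.card ι := by
  rw [← Fintype.card_subtype, DomMulAct.stabilizer_card]
  simp [hc]

theorem le_T {n : ℕ} {D : Set ℕ} (S : Finset (Equiv.Perm (Fin n)))
    (hS : ∀ π ∈ S, ∀ σ ∈ S, π ≠ σ → ∃ i : Fin n, ((π i : ℤ) - (σ i : ℤ)).natAbs ∈ D) :
    S.card ≤ T n D := by
  refine le_csSup ⟨Fintype.card (Equiv.Perm (Fin n)), ?_⟩ ⟨S, rfl, hS⟩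
  rintro _ ⟨S', rfl, -⟩
  exact S'.card_le_univ

theorem T_le {n b : ℕ} {D : Set ℕ}
    (h : ∀ S : Finset (Equiv.Perm (Fin n)),
      (∀ π ∈ S, ∀ σ ∈ S, π ≠ σ → ∃ i : Fin n, ((π i : ℤ) - (σ i : ℤ)).natAbs ∈ D) →
      S.card ≤ b) : T n D ≤ b := by
  refine csSup_le ⟨0, ∅, by simp⟩ ?_
  rintro _ ⟨S, rfl, hS⟩
  exact h S hS

/-- If `n = 4^t`, then `((√n)!)^(√n) ≤ T(n, E) ≤ n! / ((√n)!)^(√n)`,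
where `√n = 2^t`. -/
theorem T_Eset_bounds (t n : ℕ) (hn : n = 4 ^ t) :
    (Nat.factorial (2 ^ t)) ^ (2 ^ t) ≤ T n Eset ∧
    T n Eset ≤ Nat.factorial n / (Nat.factorial (2 ^ t)) ^ (2 ^ t) := by
  subst hn
  constructor
  · have hcard := card_perm_preserving _ (card_oddClass_fiber t)
    rw [Fintype.card_fin] at hcard
    rw [← hcard]
    refine le_T _ fun π hπ σ hσ hne ↦ ?_
    simp only [Finset.mem_filter, Finset.mem_univ, true_and] at hπ hσ
    obtain ⟨i, hi⟩ : ∃ i, π i ≠ σ i := by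
      by_contra! h
      exact hne (Equiv.ext h)
    have h := congrFun (hπ.trans hσ.symm) i
    exact ⟨i, natAbs_sub_mem_Eset (π i).2 (σ i).2 (Fin.val_ne_of_ne hi) (congrArg Fin.val h)⟩
  · refine T_le fun S hS ↦ ?_
    rw [Nat.le_div_iff_mul_le (by positivity)]
    have hcard := card_perm_preserving _ (card_evenClass_fiber t)
    rw [Fintype.card_fin] at hcard
    rw [← hcard, ← Finset.card_product]
    calc _ ≤ (Finset.univ : Finset (Equiv.Perm (Fin (4 ^ t)))).card := by
          refine Finset.card_le_card_of_injOn (fun p ↦ p.2 * p.1) (by simp) ?_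
          rintro ⟨π, g⟩ hp ⟨σ, h⟩ hq heq
          simp only [Finset.coe_product, Set.mem_prod, Finset.mem_coe, Finset.mem_filter,
            Finset.mem_univ, true_and] at hp hq heq
          have hπσ : π = σ := by
            by_contra hne
            obtain ⟨i, hi⟩ := hS π hp.1 σ hq.1 hne
            refine natAbs_sub_notMem_Eset (π i).2 (σ i).2 ?_ hi
            have h1 := congrFun hp.2 (π i)
            have h2 := congrFun hq.2 (σ i)
            have h3 : g (π i) = h (σ i) := congrArg (· i) heq
            simp only [Function.comp_apply] at h1 h2
            exact congrArg Fin.val (h1.symm.trans ((congrArg _ h3).trans h2))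
          subst hπσ
          rw [mul_right_cancel heq]
      _ = _ := by rw [Finset.card_univ, Fintype.card_perm, Fintype.card_fin]
end

section
/- Let E = {m ∈ ℕ⁺ : ex(m) is even}, where ex(m) denotes the exponent of 2 in the prime factorization of m (the 2-adic valuation), and let Ē be its complement in the positive integers. If n = 4^t for some natural number t, then ( (√n)! )^{√n} ≤ T(n, Ē) ≤ n! / ( (√n)! )^{√n}, where √n = 2^t. -/
/-- The complement (within the positive integers) of the set of positive
integers whose 2-adic valuation is even, i.e. the set of positive integers
whose 2-adic valuation is odd. -/
def EsetCompl : Set ℕ := {m : ℕ | 0 < m ∧ ¬ Even (padicValNat 2 m)}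

/-- The number whose binary digits are the first `t` odd-position binary digits of `x`. -/
def oddBits (t x : ℕ) : ℕ := evenBits t (x / 2)

theorem oddBits_succ (t x : ℕ) :
    oddBits (t + 1) x = x / 2 % 2 + 2 * oddBits t (x / 4) := by
  simp only [oddBits, evenBits]
  rw [show x / 2 / 4 = x / 4 / 2 by omega]

theorem padicValNat_two_four_mul {d : ℕ} (hd : d ≠ 0) :
    padicValNat 2 (4 * d) = padicValNat 2 d + 2 := by
  rw [show 4 * d = 2 ^ 2 * d by norm_num, padicValNat.mul (by norm_num) hd,
    padicValNat.prime_pow, add_comm]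

theorem padicValNat_two_eq_one {d : ℕ} (hd : d % 4 = 2) : padicValNat 2 d = 1 := by
  rw [show d = 2 * (d / 2) by omega, padicValNat.mul (by norm_num) (by omega),
    padicValNat.self (by norm_num), padicValNat.eq_zero_of_not_dvd (by omega)]

theorem not_even_padicValNat_of_evenBits_eq (t : ℕ) {x y : ℕ} (hx : x < 4 ^ t) (hy : y < 4 ^ t)
    (hxy : x ≠ y) (h : evenBits t x = evenBits t y) :
    ¬ Even (padicValNat 2 ((x : ℤ) - y).natAbs) := by
  induction t generalizing x y with
  | zero => simp at hx hy; omega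
  | succ t ih =>
    simp only [evenBits] at h
    rw [pow_succ] at hx hy
    by_cases hmod : x % 4 = y % 4
    · have hdiff : ((x : ℤ) - y).natAbs = 4 * (((x / 4 : ℕ) : ℤ) - (y / 4 : ℕ)).natAbs := by
        omega
      rw [hdiff, padicValNat_two_four_mul (by omega), Nat.even_add]
      simpa using ih (x := x / 4) (y := y / 4) (by omega) (by omega) (by omega) (by omega)
    · rw [padicValNat_two_eq_one (by omega)]
      decide

theorem even_padicValNat_of_oddBits_eq (t : ℕ) {x y : ℕ} (hx : x < 4 ^ t) (hy : y < 4 ^ t)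
    (h : oddBits t x = oddBits t y) :
    Even (padicValNat 2 ((x : ℤ) - y).natAbs) := by
  induction t generalizing x y with
  | zero =>
    obtain rfl : x = y := by simp at hx hy; omega
    simp
  | succ t ih =>
    rcases eq_or_ne x y with rfl | hxy
    · simp
    rw [oddBits_succ, oddBits_succ] at h
    rw [pow_succ] at hx hy
    by_cases hmod : x % 4 = y % 4
    · have hdiff : ((x : ℤ) - y).natAbs = 4 * (((x / 4 : ℕ) : ℤ) - (y / 4 : ℕ)).natAbs := by
        omega
      rw [hdiff, padicValNat_two_four_mul (by omega), Nat.even_add]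
      simpa using ih (x := x / 4) (y := y / 4) (by omega) (by omega) (by omega)
    · rw [padicValNat.eq_zero_of_not_dvd (by omega)]
      exact Even.zero

/-- Splitting a `2t`-bit number into its even-position and odd-position bits. -/
noncomputable def bitSplit (t : ℕ) : Fin (4 ^ t) ≃ Fin (2 ^ t) × Fin (2 ^ t) :=
  Equiv.ofBijective
    (fun x => (⟨evenBits t x, evenBits_lt t x⟩, ⟨oddBits t x, evenBits_lt t _⟩)) <| by
    refine (Fintype.bijective_iff_injective_and_card _).2 ⟨fun x y hxy => ?_, ?_⟩
    · rw [Prod.mk.injEq] at hxy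
      by_contra hne
      exact not_even_padicValNat_of_evenBits_eq t x.2 y.2 (fun h => hne (Fin.ext h))
        (Fin.ext_iff.1 hxy.1)
        (even_padicValNat_of_oddBits_eq t x.2 y.2 (Fin.ext_iff.1 hxy.2))
    · simp [← mul_pow]

/-- The permutation of `α` acting by `σ a` on the fibre over `a` of the first coordinate of
`e : α ≃ β × γ`. -/
def fiberPerm {α β γ : Type*} (e : α ≃ β × γ) (σ : β → Equiv.Perm γ) : Equiv.Perm α :=
  (e.trans (Equiv.prodCongrRight σ)).trans e.symm

theorem apply_fiberPerm {α β γ : Type*} (e : α ≃ β × γ) (σ : β → Equiv.Perm γ) (x : α) :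
    e (fiberPerm e σ x) = ((e x).1, σ (e x).1 (e x).2) := by
  simp [fiberPerm, Equiv.prodCongrRight]

theorem fiberPerm_injective {α β γ : Type*} (e : α ≃ β × γ) :
    Function.Injective (fiberPerm e) := by
  intro σ τ h
  ext b c
  have := apply_fiberPerm e σ (e.symm (b, c))
  rw [h, apply_fiberPerm] at this
  simpa using this.symm

theorem le_T_of_fibers_clique {n m : ℕ} {D : Set ℕ} (e : Fin n ≃ Fin m × Fin m)
    (hD : ∀ x y : Fin n, x ≠ y → (e x).1 = (e y).1 → ((x : ℤ) - (y : ℤ)).natAbs ∈ D) :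
    m.factorial ^ m ≤ T n D := by
  classical
  refine le_csSup ⟨Fintype.card (Equiv.Perm (Fin n)), ?_⟩
    ⟨Finset.univ.map ⟨fiberPerm e, fiberPerm_injective e⟩, ?_, ?_⟩
  · rintro _ ⟨S, rfl, -⟩
    exact S.card_le_univ
  · simp [Fintype.card_perm]
  · simp only [Finset.mem_map, Finset.mem_univ, true_and, Function.Embedding.coeFn_mk]
    rintro _ ⟨σ, rfl⟩ _ ⟨τ, rfl⟩ hne
    obtain ⟨i, hi⟩ := DFunLike.ne_iff.1 hne
    exact ⟨i, hD _ _ hi (by rw [apply_fiberPerm, apply_fiberPerm])⟩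

theorem T_le_of_fibers_independent {n m : ℕ} {D : Set ℕ} (e : Fin n ≃ Fin m × Fin m)
    (hD : ∀ x y : Fin n, (e x).1 = (e y).1 → ((x : ℤ) - (y : ℤ)).natAbs ∉ D) :
    T n D ≤ n.factorial / m.factorial ^ m := by
  classical
  refine csSup_le ⟨0, ∅, by simp⟩ ?_
  rintro _ ⟨S, rfl, hS⟩
  rw [Nat.le_div_iff_mul_le (pow_pos m.factorial_pos m)]
  have hinj : Function.Injective
      fun p : S × (Fin m → Equiv.Perm (Fin m)) => fiberPerm e p.2 * (p.1 : Equiv.Perm (Fin n)) := by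
    rintro ⟨⟨π, hπ⟩, σ⟩ ⟨⟨ρ, hρ⟩, τ⟩ h
    dsimp only at h
    have hπρ : π = ρ := by
      by_contra hne
      obtain ⟨i, hi⟩ := hS π hπ ρ hρ hne
      refine hD _ _ ?_ hi
      have hei := congrArg (fun f : Equiv.Perm (Fin n) => (e (f i)).1) h
      simpa only [Equiv.Perm.mul_apply, apply_fiberPerm] using hei
    subst hπρ
    rw [fiberPerm_injective e (mul_right_cancel h)]
  simpa [Fintype.card_perm] using Fintype.card_le_of_injective _ hinj

/-- If `n = 4^t`, then `((√n)!)^(√n) ≤ T(n, Ē) ≤ n! / ((√n)!)^(√n)`,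
where `√n = 2^t`. -/
theorem T_EsetCompl_bounds (t n : ℕ) (hn : n = 4 ^ t) :
    (Nat.factorial (2 ^ t)) ^ (2 ^ t) ≤ T n EsetCompl ∧
    T n EsetCompl ≤ Nat.factorial n / (Nat.factorial (2 ^ t)) ^ (2 ^ t) := by
  subst hn
  refine ⟨le_T_of_fibers_clique (bitSplit t) fun x y hne h => ⟨?_, ?_⟩,
    T_le_of_fibers_independent ((bitSplit t).trans (Equiv.prodComm _ _)) fun x y h hxy => ?_⟩
  · have := Fin.val_ne_of_ne hne
    omega
  · exact not_even_padicValNat_of_evenBits_eq t x.2 y.2 (Fin.val_ne_of_ne hne) (Fin.ext_iff.1 h)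
  · exact hxy.2 (even_padicValNat_of_oddBits_eq t x.2 y.2 (Fin.ext_iff.1 h))
end

section
/- Let x and y be natural numbers with x > y. If the binary expansions of x and y agree in all positions of odd 0-based index (equivalently, in all even-indexed positions when positions are counted from 1 starting at the least significant bit), then the exponent of 2 in the prime factorization of x − y is even. -/
/-- The bits of `x` and `y` differ at the position given by the exponent of `2` in `x - y`. -/
theorem Nat.testBit_padicValNat_sub_ne {x y : ℕ} (hxy : y < x) :
    x.testBit (padicValNat 2 (x - y)) ≠ y.testBit (padicValNat 2 (x - y)) := by
  set s := padicValNat 2 (x - y) with hs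
  obtain ⟨m, hm⟩ : 2 ^ s ∣ x - y := pow_padicValNat_dvd
  have hm_odd : ¬ 2 ∣ m := by
    rintro ⟨k, rfl⟩
    refine pow_succ_padicValNat_not_dvd (p := 2) (Nat.sub_ne_zero_of_lt hxy) ?_
    rw [← hs]
    exact ⟨k, by rw [hm, pow_succ, mul_assoc]⟩
  have hx : x = y + 2 ^ s * m := by omega
  have hdiv : x / 2 ^ s = y / 2 ^ s + m := by
    rw [hx, Nat.add_mul_div_left _ _ (by positivity)]
  rw [Nat.testBit_eq_decide_div_mod_eq, Nat.testBit_eq_decide_div_mod_eq, ne_eq,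
    decide_eq_decide, hdiv]
  omega

/-- If `x > y` and the binary expansions of `x` and `y` agree in all positions
of odd (0-based) index, then the exponent of `2` in `x - y` is even. -/
theorem even_padicValNat_sub_of_agree_odd_bits (x y : ℕ) (hxy : x > y)
    (h : ∀ i : ℕ, Odd i → x.testBit i = y.testBit i) :
    Even (padicValNat 2 (x - y)) := by
  by_contra hodd
  exact Nat.testBit_padicValNat_sub_ne hxy (h _ (Nat.not_even_iff_odd.mp hodd))
end

section
/- Let p and q be natural numbers with 0 < p < q. Then there exists a set E of positive integers such that for every natural number k ≥ 1, setting n = 2^{qk}, a = 2^{pk} and b = 2^{(q−p)k} (so that a = n^{p/q} and b = n^{1−p/q}), the following bounds hold: (a!)^b ≤ T(n, E) ≤ n!/((b!)^a) and (b!)^a ≤ T(n, Ē) ≤ n!/((a!)^b), where Ē is the complement of E in the positive integers. -/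
/-- The positive integers whose expansion in base `N` uses signed digits of absolute value
less than `P`. -/
def signedDigitSet (N P : ℕ) : Set ℕ :=
  {m | 0 < m ∧ ∃ (k : ℕ) (c : Fin k → ℤ), (∀ i, |c i| < P) ∧ (m : ℤ) = ∑ i, c i * (N : ℤ) ^ (i : ℕ)}

theorem card_perm_preserving_fst {α β γ : Type*} [Fintype α] [Fintype β] [Fintype γ]
    (e : α × β ≃ γ) :
    Nat.card {g : Equiv.Perm γ // (fun x => (e.symm x).1) ∘ g = fun x => (e.symm x).1} =
      (Fintype.card β).factorial ^ Fintype.card α := by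
  classical
  rw [Nat.card_eq_fintype_card, DomMulAct.stabilizer_card]
  have h (a : α) : Fintype.card {x : γ // (e.symm x).1 = a} = Fintype.card β :=
    Fintype.card_congr
      { toFun := fun x => (e.symm x.1).2
        invFun := fun b => ⟨e (a, b), by simp⟩
        left_inv := by rintro ⟨x, rfl⟩; simp
        right_inv := fun b => by simp }
  simp [h]

theorem factorial_pow_le_T {α β : Type*} [Fintype α] [Fintype β] {n : ℕ} {D : Set ℕ}
    (e : α × β ≃ Fin n)
    (h : ∀ a b b', b ≠ b' → ((e (a, b) : ℤ) - (e (a, b') : ℤ)).natAbs ∈ D) :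
    (Fintype.card β).factorial ^ Fintype.card α ≤ T n D := by
  classical
  refine le_csSup (bddAbove_card_pairwise_different n D)
    ⟨Finset.univ.filter fun g : Equiv.Perm (Fin n) =>
      (fun x => (e.symm x).1) ∘ g = fun x => (e.symm x).1, ?_, ?_⟩
  · rw [← card_perm_preserving_fst e, Nat.card_eq_fintype_card, Fintype.card_subtype]
  · intro π hπ σ hσ hne
    simp only [Finset.mem_filter, Finset.mem_univ, true_and] at hπ hσ
    obtain ⟨i, hi⟩ : ∃ i, π i ≠ σ i := by
      by_contra! hc
      exact hne (Equiv.ext hc)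
    have h1 : (e.symm (π i)).1 = (e.symm (σ i)).1 :=
      (congrFun hπ i).trans (congrFun hσ i).symm
    have h2 : (e.symm (π i)).2 ≠ (e.symm (σ i)).2 := fun h2 =>
      hi (e.symm.injective (Prod.ext h1 h2))
    have h3 := h (e.symm (π i)).1 _ _ h2
    nth_rewrite 2 [h1] at h3
    exact ⟨i, by simpa using h3⟩

theorem T_le_factorial_div {α β : Type*} [Fintype α] [Fintype β] {n : ℕ} {D : Set ℕ}
    (e : α × β ≃ Fin n)
    (h : ∀ a b b', ((e (a, b) : ℤ) - (e (a, b') : ℤ)).natAbs ∉ D) :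
    T n D ≤ n.factorial / (Fintype.card β).factorial ^ Fintype.card α := by
  classical
  refine csSup_le ⟨0, ∅, by simp⟩ ?_
  rintro _ ⟨S, rfl, hS⟩
  rw [Nat.le_div_iff_mul_le (pow_pos (Nat.factorial_pos _) _), ← card_perm_preserving_fst e]
  let φ : S × {g : Equiv.Perm (Fin n) // (fun x => (e.symm x).1) ∘ g = fun x => (e.symm x).1} →
      Equiv.Perm (Fin n) := fun x => x.2.1 * x.1.1
  have hφ : Function.Injective φ := by
    rintro ⟨⟨s, hs⟩, g, hg⟩ ⟨⟨s', hs'⟩, g', hg'⟩ heq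
    have heq : g * s = g' * s' := heq
    have hss : s = s' := by
      by_contra hne
      obtain ⟨i, hi⟩ := hS s hs s' hs' hne
      have hgi : g (s i) = g' (s' i) := congrArg (fun f : Equiv.Perm (Fin n) => f i) heq
      have h1 : (e.symm (s i)).1 = (e.symm (s' i)).1 := by
        have ha := congrFun hg (s i)
        have hb := congrFun hg' (s' i)
        simp only [Function.comp_apply] at ha hb
        rw [← ha, ← hb, hgi]
      have h3 := h (e.symm (s i)).1 (e.symm (s i)).2 (e.symm (s' i)).2
      nth_rewrite 2 [h1] at h3
      exact h3 (by simpa using hi)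
    subst hss
    have hgg : g = g' := mul_right_cancel heq
    subst hgg
    rfl
  simpa only [Nat.card_prod, Nat.card_perm, Nat.card_eq_finsetCard, Nat.card_fin] using
    Nat.card_le_card_of_injective φ hφ

theorem sum_signedDigit_eq_zero {P R : ℤ} (hP : 0 < P) (hR : 0 < R) :
    ∀ {k l : ℕ} (c : Fin k → ℤ) (d : Fin l → ℤ), (∀ i, |c i| < P) → (∀ i, |d i| < R) →
      ∑ i, c i * (P * R) ^ (i : ℕ) = P * ∑ i, d i * (P * R) ^ (i : ℕ) →
      ∑ i, c i * (P * R) ^ (i : ℕ) = 0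
  | 0, _, _, _, _, _, _ => by simp
  | _ + 1, 0, _, _, _, _, h => by rw [h]; simp
  | k + 1, l + 1, c, d, hc, hd, h => by
    have key (m : ℕ) (f : Fin (m + 1) → ℤ) : ∑ i, f i * (P * R) ^ (i : ℕ) =
        f 0 + P * R * ∑ i : Fin m, f i.succ * (P * R) ^ (i : ℕ) := by
      rw [Fin.sum_univ_succ, Finset.mul_sum]
      simp only [Fin.val_zero, pow_zero, mul_one, Fin.val_succ, pow_succ]
      congr 1
      exact Finset.sum_congr rfl fun i _ => by ring
    have ih := sum_signedDigit_eq_zero hP hR (fun i => c i.succ) (fun i => d i.succ)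
      (fun i => hc _) (fun i => hd _)
    rw [key, key] at h
    rw [key]
    set X := ∑ i : Fin k, c i.succ * (P * R) ^ (i : ℕ)
    set Y := ∑ i : Fin l, d i.succ * (P * R) ^ (i : ℕ)
    have hc0 : c 0 = 0 := Int.eq_zero_of_abs_lt_dvd
      (⟨d 0 + P * R * Y - R * X, by linear_combination h⟩ : P ∣ c 0) (hc 0)
    have h' : R * X = d 0 + P * R * Y :=
      mul_left_cancel₀ hP.ne' (by linear_combination h - hc0)
    have hd0 : d 0 = 0 := Int.eq_zero_of_abs_lt_dvd
      (⟨X - P * Y, by linear_combination -h'⟩ : R ∣ d 0) (hd 0)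
    have hX : X = P * Y := mul_left_cancel₀ hR.ne' (by linear_combination h' + hd0)
    rw [hc0, ih hX]
    simp

/-- Splitting each base-`R * P` digit into its quotient and remainder modulo `P`. -/
def digitSplitEquiv (R P k : ℕ) : (Fin k → Fin R) × (Fin k → Fin P) ≃ Fin ((R * P) ^ k) :=
  (Equiv.arrowProdEquivProdArrow (Fin k) (fun _ => Fin R) (fun _ => Fin P)).symm.trans
    ((Equiv.arrowCongr (Equiv.refl _) finProdFinEquiv).trans finFunctionFinEquiv)

theorem digitSplitEquiv_apply (R P k : ℕ) (x : Fin k → Fin R) (y : Fin k → Fin P) :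
    (digitSplitEquiv R P k (x, y) : ℤ) =
      ∑ i, (y i : ℤ) * ((R * P : ℕ) : ℤ) ^ (i : ℕ) +
        P * ∑ i, (x i : ℤ) * ((R * P : ℕ) : ℤ) ^ (i : ℕ) := by
  rw [Finset.mul_sum, ← Finset.sum_add_distrib]
  simp only [digitSplitEquiv, Equiv.trans_apply, finFunctionFinEquiv_apply]
  push_cast
  refine Finset.sum_congr rfl fun i _ => ?_
  simp [Equiv.arrowProdEquivProdArrow]
  ring

theorem abs_fin_sub_lt {m : ℕ} (x y : Fin m) : |(x : ℤ) - (y : ℤ)| < m := by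
  rw [abs_lt]
  omega

theorem digitSplitEquiv_sub_mem (R P k : ℕ) (x : Fin k → Fin R) {y y' : Fin k → Fin P}
    (h : y ≠ y') :
    ((digitSplitEquiv R P k (x, y) : ℤ) - (digitSplitEquiv R P k (x, y') : ℤ)).natAbs ∈
      signedDigitSet (R * P) P := by
  have hne : (digitSplitEquiv R P k (x, y) : ℤ) - (digitSplitEquiv R P k (x, y') : ℤ) ≠ 0 := by
    intro h0
    exact h (Prod.ext_iff.1 ((digitSplitEquiv R P k).injective
      (Fin.ext (Int.ofNat_inj.1 (sub_eq_zero.1 h0))) : (x, y) = (x, y'))).2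
  refine ⟨Int.natAbs_pos.2 hne, k, ?_⟩
  have hsub : (digitSplitEquiv R P k (x, y) : ℤ) - (digitSplitEquiv R P k (x, y') : ℤ) =
      ∑ i, ((y i : ℤ) - y' i) * ((R * P : ℕ) : ℤ) ^ (i : ℕ) := by
    simp only [digitSplitEquiv_apply, sub_mul, Finset.sum_sub_distrib]
    ring
  rcases Int.natAbs_eq ((digitSplitEquiv R P k (x, y) : ℤ) - (digitSplitEquiv R P k (x, y') : ℤ))
    with h1 | h1
  · exact ⟨fun i => (y i : ℤ) - y' i, fun i => abs_fin_sub_lt _ _, by rw [← h1, hsub]⟩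
  · refine ⟨fun i => (y' i : ℤ) - y i, fun i => abs_fin_sub_lt _ _, ?_⟩
    have hneg : ∑ i, ((y' i : ℤ) - y i) * ((R * P : ℕ) : ℤ) ^ (i : ℕ) =
        -∑ i, ((y i : ℤ) - y' i) * ((R * P : ℕ) : ℤ) ^ (i : ℕ) := by
      rw [← Finset.sum_neg_distrib]
      exact Finset.sum_congr rfl fun i _ => by ring
    rw [hneg, ← hsub]
    omega

theorem digitSplitEquiv_sub_notMem {R P : ℕ} (hR : 0 < R) (hP : 0 < P) (k : ℕ)
    (x x' : Fin k → Fin R) (y : Fin k → Fin P) :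
    ((digitSplitEquiv R P k (x, y) : ℤ) - (digitSplitEquiv R P k (x', y) : ℤ)).natAbs ∉
      signedDigitSet (R * P) P := by
  rintro ⟨hpos, l, c, hc, hm⟩
  have hsub (x x' : Fin k → Fin R) :
      (digitSplitEquiv R P k (x, y) : ℤ) - (digitSplitEquiv R P k (x', y) : ℤ) =
      P * ∑ i, ((x i : ℤ) - x' i) * ((P : ℤ) * R) ^ (i : ℕ) := by
    simp only [digitSplitEquiv_apply, sub_mul, Finset.sum_sub_distrib, Nat.cast_mul,
      mul_comm (R : ℤ)]
    ring
  rw [Nat.cast_mul, mul_comm (R : ℤ)] at hm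
  have hzero : ∑ i, c i * ((P : ℤ) * R) ^ (i : ℕ) = 0 := by
    rcases Int.natAbs_eq
      ((digitSplitEquiv R P k (x, y) : ℤ) - (digitSplitEquiv R P k (x', y) : ℤ)) with h1 | h1
    · refine sum_signedDigit_eq_zero (by exact_mod_cast hP) (by exact_mod_cast hR) c
        (fun i => (x i : ℤ) - x' i) hc (fun i => abs_fin_sub_lt _ _) ?_
      rw [← hm, ← h1, hsub]
    · refine sum_signedDigit_eq_zero (by exact_mod_cast hP) (by exact_mod_cast hR) c
        (fun i => (x' i : ℤ) - x i) hc (fun i => abs_fin_sub_lt _ _) ?_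
      rw [← hm, ← hsub]
      omega
  omega

/-- For `0 < p < q` there is a set `E` of positive integers such that for
every `k ≥ 1`, with `n = 2^(qk)`, `a = 2^(pk)` and `b = 2^((q-p)k)`, one has
`(a!)^b ≤ T(n,E) ≤ n!/((b!)^a)` and `(b!)^a ≤ T(n,Ē) ≤ n!/((a!)^b)`. -/
theorem exists_intermediate_growth (p q : ℕ) (hp : 0 < p) (hpq : p < q) :
    ∃ E : Set ℕ, E ⊆ {m : ℕ | 0 < m} ∧
      ∀ k : ℕ, 1 ≤ k →
        (Nat.factorial (2 ^ (p * k))) ^ (2 ^ ((q - p) * k)) ≤ T (2 ^ (q * k)) E ∧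
        T (2 ^ (q * k)) E ≤
          Nat.factorial (2 ^ (q * k)) /
            (Nat.factorial (2 ^ ((q - p) * k))) ^ (2 ^ (p * k)) ∧
        (Nat.factorial (2 ^ ((q - p) * k))) ^ (2 ^ (p * k)) ≤
          T (2 ^ (q * k)) {m : ℕ | 0 < m ∧ m ∉ E} ∧
        T (2 ^ (q * k)) {m : ℕ | 0 < m ∧ m ∉ E} ≤
          Nat.factorial (2 ^ (q * k)) /
            (Nat.factorial (2 ^ (p * k))) ^ (2 ^ ((q - p) * k)) := by
  refine ⟨signedDigitSet (2 ^ (q - p) * 2 ^ p) (2 ^ p), fun m hm => hm.1, fun k _ => ?_⟩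
  have hR : 0 < 2 ^ (q - p) := by positivity
  have hP : 0 < 2 ^ p := by positivity
  have hn : 2 ^ (q * k) = (2 ^ (q - p) * 2 ^ p) ^ k := by
    rw [← pow_add, Nat.sub_add_cancel hpq.le, pow_mul]
  rw [hn, pow_mul 2 p k, pow_mul 2 (q - p) k]
  generalize 2 ^ (q - p) = R at *
  generalize 2 ^ p = P at *
  let e := digitSplitEquiv R P k
  let e' := (Equiv.prodComm (Fin k → Fin P) (Fin k → Fin R)).trans e
  have h1 := factorial_pow_le_T (D := signedDigitSet (R * P) P) e
    fun x y y' h => digitSplitEquiv_sub_mem R P k x h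
  have h2 := T_le_factorial_div (D := signedDigitSet (R * P) P) e'
    fun y x x' => digitSplitEquiv_sub_notMem hR hP k x x' y
  have h3 := factorial_pow_le_T (D := {m : ℕ | 0 < m ∧ m ∉ signedDigitSet (R * P) P}) e'
    fun y x x' h => ⟨Int.natAbs_pos.2 fun h0 => h (Prod.ext_iff.1 (e'.injective
      (Fin.ext (Int.ofNat_inj.1 (sub_eq_zero.1 h0))) : (y, x) = (y, x'))).2,
      digitSplitEquiv_sub_notMem hR hP k x x' y⟩
  have h4 := T_le_factorial_div (D := {m : ℕ | 0 < m ∧ m ∉ signedDigitSet (R * P) P}) e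
    fun x y y' hm => by
      rcases eq_or_ne y y' with rfl | hy
      · simp at hm
      · exact hm.2 (digitSplitEquiv_sub_mem R P k x hy)
  simp only [Fintype.card_fun, Fintype.card_fin] at h1 h2 h3 h4
  exact ⟨h1, h2, h3, h4⟩
end

section
/- Let r ≥ 1, let M be a finite simple graph on vertex set {0,1,…,r−1}, and let G be the residue graph on ℕ defined by: a and b are adjacent in G if and only if (a mod r) and (b mod r) are adjacent in M. Let Q be the uniform distribution on {0,…,r−1}. Then lim_{n→∞} (1/n) log₂ T_G(n) exists and equals C(M, Q), the Shannon capacity of M within the type Q. -/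
open Filter

/-- For a graph `G` on `ℕ`, two permutations of `[n] = {1,…,n}` are
`G`-different if at some position their values are adjacent in `G`.
`TG G n` is the maximum cardinality of a set of pairwise `G`-different
permutations of `[n]`. -/
noncomputable def TG (G : SimpleGraph ℕ) (n : ℕ) : ℕ :=
  sSup {k | ∃ S : Finset (Equiv.Perm (Fin n)), S.card = k ∧
    ∀ π ∈ S, ∀ σ ∈ S, π ≠ σ →
      ∃ i : Fin n, G.Adj ((π i : ℕ) + 1) ((σ i : ℕ) + 1)}

/-- `omegaType M P ε n` is the largest cardinality of a set of pairwise
`M`-different sequences of length `n`, all of whose types are `ε`-close to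
the distribution `P`. -/
noncomputable def omegaType {r : ℕ} (M : SimpleGraph (Fin r)) (P : Fin r → ℝ)
    (ε : ℝ) (n : ℕ) : ℕ :=
  sSup {k | ∃ S : Finset (Fin n → Fin r), S.card = k ∧
    (∀ x ∈ S, ∀ a : Fin r,
      |((Finset.univ.filter fun i : Fin n => x i = a).card : ℝ) / n - P a| ≤ ε) ∧
    ∀ x ∈ S, ∀ y ∈ S, x ≠ y → ∃ i : Fin n, M.Adj (x i) (y i)}

/-- The Shannon capacity of `M` within the type `P`:
`C(M,P) = lim_{ε→0⁺} limsup_{n→∞} (1/n) log₂ ω(M,P,ε,n)`.  Since the inner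
`limsup` is monotone nondecreasing in `ε`, the limit as `ε → 0⁺` equals the
infimum over all `ε > 0`. -/
noncomputable def capacityWithin {r : ℕ} (M : SimpleGraph (Fin r))
    (P : Fin r → ℝ) : ℝ :=
  ⨅ ε : {e : ℝ // 0 < e},
    Filter.atTop.limsup fun n : ℕ => Real.logb 2 (omegaType M P ε n : ℝ) / n

/-- The residue modulo `r` of the `i`-th element of `{1,…,n}`. -/
def succResidue {r : ℕ} (hr : 0 < r) {n : ℕ} (i : Fin n) : Fin r :=
  ⟨((i : ℕ) + 1) % r, Nat.mod_lt _ hr⟩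

theorem abs_card_succResidue_fiber_sub_lt {r : ℕ} (hr : 0 < r) (n : ℕ) (a : Fin r) :
    |((Finset.univ.filter fun i : Fin n => succResidue hr i = a).card : ℝ) - n / r| < 1 := by
  have hcard : (Finset.univ.filter fun i : Fin n => succResidue hr i = a).card =
      ((Finset.Ioc 0 n).filter fun k => k ≡ a [MOD r]).card := by
    refine Finset.card_bij (fun i _ => (i : ℕ) + 1) ?_ ?_ ?_
    · intro i hi
      simp only [succResidue, Finset.mem_filter, Finset.mem_univ, true_and, Fin.ext_iff] at hi
      simp only [Finset.mem_filter, Finset.mem_Ioc, Nat.ModEq, Nat.mod_eq_of_lt a.2]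
      exact ⟨⟨by omega, by omega⟩, hi⟩
    · intro i _ j _ h
      exact Fin.ext (by omega)
    · intro k hk
      simp only [Finset.mem_filter, Finset.mem_Ioc, Nat.ModEq, Nat.mod_eq_of_lt a.2] at hk
      refine ⟨⟨k - 1, by omega⟩, ?_, by simp only; omega⟩
      simp only [succResidue, Finset.mem_filter, Finset.mem_univ, true_and, Fin.ext_iff]
      rw [Nat.sub_add_cancel (by omega)]
      exact hk.2
  have hr' : (0 : ℚ) < r := by exact_mod_cast hr
  have hfloor := Nat.Ioc_filter_modEq_card 0 n hr a
  rw [← hcard] at hfloor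
  have hle : ⌊((0 : ℕ) - (a : ℕ) : ℚ) / r⌋ ≤ ⌊((n : ℕ) - (a : ℕ) : ℚ) / r⌋ := by
    apply Int.floor_le_floor
    gcongr
    positivity
  rw [max_eq_left (by omega)] at hfloor
  have hq : |((Finset.univ.filter fun i : Fin n => succResidue hr i = a).card : ℚ) - n / r|
      < 1 := by
    have hfloor' : ((Finset.univ.filter fun i : Fin n => succResidue hr i = a).card : ℚ) =
        (⌊((n : ℕ) - (a : ℕ) : ℚ) / r⌋ - ⌊((0 : ℕ) - (a : ℕ) : ℚ) / r⌋ : ℤ) := by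
      exact_mod_cast hfloor
    have h1 := Int.floor_le (((n : ℕ) - (a : ℕ) : ℚ) / r)
    have h2 := Int.lt_floor_add_one (((n : ℕ) - (a : ℕ) : ℚ) / r)
    have h3 := Int.floor_le (((0 : ℕ) - (a : ℕ) : ℚ) / r)
    have h4 := Int.lt_floor_add_one (((0 : ℕ) - (a : ℕ) : ℚ) / r)
    have h5 : (n : ℚ) / r = ((n : ℕ) - (a : ℕ) : ℚ) / r - ((0 : ℕ) - (a : ℕ) : ℚ) / r := by
      push_cast; ring
    rw [hfloor', h5, abs_lt]
    push_cast at *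
    constructor <;> linarith
  have hR : ((|((Finset.univ.filter fun i : Fin n => succResidue hr i = a).card : ℚ) - n / r| : ℚ)
      : ℝ) < ((1 : ℚ) : ℝ) := Rat.cast_lt.2 hq
  push_cast at hR
  exact hR

theorem card_succResidue_fiber_mul {r : ℕ} (hr : 0 < r) (K : ℕ) (a : Fin r) :
    (Finset.univ.filter fun i : Fin (r * K) => succResidue hr i = a).card = K := by
  have h := abs_card_succResidue_fiber_sub_lt hr (r * K) a
  have hr' : (r : ℝ) ≠ 0 := by positivity
  rw [Nat.cast_mul, mul_div_cancel_left₀ _ hr', abs_lt] at h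
  obtain ⟨h1, h2⟩ := h
  have h1' : (K : ℝ) < (Finset.univ.filter fun i : Fin (r * K) => succResidue hr i = a).card + 1 :=
    by linarith
  have h2' : ((Finset.univ.filter fun i : Fin (r * K) => succResidue hr i = a).card : ℝ) < K + 1 :=
    by linarith
  norm_cast at h1' h2'
  omega

theorem bddAbove_TG_set (G : SimpleGraph ℕ) (n : ℕ) :
    BddAbove {k | ∃ S : Finset (Equiv.Perm (Fin n)), S.card = k ∧
      ∀ π ∈ S, ∀ σ ∈ S, π ≠ σ →
        ∃ i : Fin n, G.Adj ((π i : ℕ) + 1) ((σ i : ℕ) + 1)} := by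
  refine ⟨Fintype.card (Equiv.Perm (Fin n)), ?_⟩
  rintro k ⟨S, rfl, -⟩
  exact S.card_le_univ

theorem exists_card_eq_TG (G : SimpleGraph ℕ) (n : ℕ) :
    ∃ S : Finset (Equiv.Perm (Fin n)), S.card = TG G n ∧
      ∀ π ∈ S, ∀ σ ∈ S, π ≠ σ → ∃ i : Fin n, G.Adj ((π i : ℕ) + 1) ((σ i : ℕ) + 1) := by
  have h := fun hne => Nat.sSup_mem hne (bddAbove_TG_set G n)
  exact h ⟨0, ∅, by simp⟩

theorem card_le_TG (G : SimpleGraph ℕ) (n : ℕ) {α : Type*} (S : Finset α)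
    (f : α → Equiv.Perm (Fin n))
    (h : ∀ x ∈ S, ∀ y ∈ S, x ≠ y → ∃ i : Fin n, G.Adj ((f x i : ℕ) + 1) ((f y i : ℕ) + 1)) :
    S.card ≤ TG G n := by
  classical
  refine le_csSup (bddAbove_TG_set G n) ⟨S.image f, ?_, ?_⟩
  · refine Finset.card_image_of_injOn fun x hx y hy hxy => ?_
    by_contra hne
    obtain ⟨i, hi⟩ := h x hx y hy hne
    rw [hxy] at hi
    exact G.irrefl hi
  · simp only [Finset.mem_image]
    rintro _ ⟨x, hx, rfl⟩ _ ⟨y, hy, rfl⟩ hne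
    exact h x hx y hy fun hxy => hne (by rw [hxy])

theorem one_le_TG (G : SimpleGraph ℕ) (n : ℕ) : 1 ≤ TG G n := by
  refine card_le_TG G n {()} (fun _ => 1) ?_
  intro x _ y _ hxy
  exact absurd rfl hxy

theorem pow_mem_upperBounds_omegaType_set {r : ℕ} (M : SimpleGraph (Fin r)) (P : Fin r → ℝ) (ε : ℝ) (n : ℕ) :
    r ^ n ∈ upperBounds {k | ∃ S : Finset (Fin n → Fin r), S.card = k ∧
      (∀ x ∈ S, ∀ a : Fin r,
        |((Finset.univ.filter fun i : Fin n => x i = a).card : ℝ) / n - P a| ≤ ε) ∧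
      ∀ x ∈ S, ∀ y ∈ S, x ≠ y → ∃ i : Fin n, M.Adj (x i) (y i)} := by
  rintro k ⟨S, rfl, -⟩
  simpa using S.card_le_univ

theorem exists_card_eq_omegaType {r : ℕ} (M : SimpleGraph (Fin r)) (P : Fin r → ℝ)
    (ε : ℝ) (n : ℕ) :
    ∃ S : Finset (Fin n → Fin r), S.card = omegaType M P ε n ∧
      (∀ x ∈ S, ∀ a : Fin r,
        |((Finset.univ.filter fun i : Fin n => x i = a).card : ℝ) / n - P a| ≤ ε) ∧
      ∀ x ∈ S, ∀ y ∈ S, x ≠ y → ∃ i : Fin n, M.Adj (x i) (y i) := by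
  have h := fun hne => Nat.sSup_mem hne ⟨_, pow_mem_upperBounds_omegaType_set M P ε n⟩
  exact h ⟨0, ∅, by simp⟩

theorem omegaType_le_pow {r : ℕ} (M : SimpleGraph (Fin r)) (P : Fin r → ℝ) (ε : ℝ) (n : ℕ) :
    omegaType M P ε n ≤ r ^ n :=
  csSup_le ⟨0, ∅, by simp⟩ (pow_mem_upperBounds_omegaType_set M P ε n)

theorem TG_le_omegaType {r : ℕ} (hr : 0 < r) {M : SimpleGraph (Fin r)} {G : SimpleGraph ℕ}
    (hG : ∀ a b : ℕ, G.Adj a b ↔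
      M.Adj ⟨a % r, Nat.mod_lt a hr⟩ ⟨b % r, Nat.mod_lt b hr⟩)
    {ε : ℝ} {n : ℕ} (hn : 0 < n) (hε : 1 / (n : ℝ) ≤ ε) :
    TG G n ≤ omegaType M (fun _ => 1 / (r : ℝ)) ε n := by
  classical
  obtain ⟨S, hcard, hS⟩ := exists_card_eq_TG G n
  let f : Equiv.Perm (Fin n) → Fin n → Fin r := fun π i => succResidue hr (π i)
  have hadj : ∀ π ∈ S, ∀ σ ∈ S, π ≠ σ → ∃ i, M.Adj (f π i) (f σ i) := by
    intro π hπ σ hσ hne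
    obtain ⟨i, hi⟩ := hS π hπ σ hσ hne
    exact ⟨i, (hG _ _).1 hi⟩
  refine le_csSup ⟨_, pow_mem_upperBounds_omegaType_set M _ ε n⟩ ⟨S.image f, ?_, ?_, ?_⟩
  · rw [← hcard]
    refine Finset.card_image_of_injOn fun π hπ σ hσ h => ?_
    by_contra hne
    obtain ⟨i, hi⟩ := hadj π hπ σ hσ hne
    rw [h] at hi
    exact M.irrefl hi
  · simp only [Finset.mem_image]
    rintro _ ⟨π, -, rfl⟩ a
    have hπ : (Finset.univ.filter fun i : Fin n => f π i = a).card =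
        (Finset.univ.filter fun i : Fin n => succResidue hr i = a).card :=
      Finset.card_equiv π (by simp [f])
    rw [hπ]
    refine le_trans ?_ hε
    have h := abs_card_succResidue_fiber_sub_lt hr n a
    have hn' : (0 : ℝ) < n := by exact_mod_cast hn
    have hr' : (r : ℝ) ≠ 0 := by positivity
    have heq : ((Finset.univ.filter fun i : Fin n => succResidue hr i = a).card : ℝ) / n - 1 / r =
        (((Finset.univ.filter fun i : Fin n => succResidue hr i = a).card : ℝ) - n / r) / n := by
      field_simp
    rw [heq, abs_div, abs_of_pos hn']
    gcongr
  · simp only [Finset.mem_image]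
    rintro _ ⟨π, hπ, rfl⟩ _ ⟨σ, hσ, rfl⟩ hne
    exact hadj π hπ σ hσ fun h => hne (by rw [h])

/-- A family of pairwise different sequences in which every symbol occurs exactly `K` times
gives a family of pairwise different permutations. -/
theorem card_le_TG_of_card_fiber_eq {r : ℕ} (hr : 0 < r) {M : SimpleGraph (Fin r)}
    {G : SimpleGraph ℕ}
    (hG : ∀ a b : ℕ, G.Adj a b ↔
      M.Adj ⟨a % r, Nat.mod_lt a hr⟩ ⟨b % r, Nat.mod_lt b hr⟩)
    {α ι : Type*} [Fintype ι] (K : ℕ) (S : Finset α) (f : α → ι → Fin r)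
    (hf : ∀ x ∈ S, ∀ a, (Finset.univ.filter fun i => f x i = a).card = K)
    (h : ∀ x ∈ S, ∀ y ∈ S, x ≠ y → ∃ i, M.Adj (f x i) (f y i)) :
    S.card ≤ TG G (r * K) := by
  classical
  rcases S.eq_empty_or_nonempty with rfl | ⟨x₀, hx₀⟩
  · simp
  have hequiv : ∀ x ∈ S, ∃ e : ι ≃ Fin (r * K), ∀ i, succResidue hr (e i) = f x i := by
    intro x hx
    refine ⟨Equiv.ofFiberEquiv (f := f x) (g := succResidue hr) fun a => Fintype.equivOfCardEq ?_,
      fun i => Equiv.ofFiberEquiv_map _ i⟩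
    rw [Fintype.card_subtype, Fintype.card_subtype, hf x hx, card_succResidue_fiber_mul]
  have : Nonempty (ι ≃ Fin (r * K)) := ⟨(hequiv x₀ hx₀).choose⟩
  choose! e he using hequiv
  refine card_le_TG G (r * K) S (fun x => (e x₀).symm.trans (e x)) fun x hx y hy hne => ?_
  obtain ⟨i, hi⟩ := h x hx y hy hne
  refine ⟨e x₀ i, (hG _ _).2 ?_⟩
  rw [← he x hx, ← he y hy] at hi
  simpa [succResidue] using hi

theorem omegaType_le_mul_TG {r : ℕ} (hr : 0 < r) {M : SimpleGraph (Fin r)} {G : SimpleGraph ℕ}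
    (hG : ∀ a b : ℕ, G.Adj a b ↔
      M.Adj ⟨a % r, Nat.mod_lt a hr⟩ ⟨b % r, Nat.mod_lt b hr⟩)
    {ε : ℝ} {m K : ℕ} (hm : 0 < m) (hK : (m : ℝ) * (1 / r + ε) ≤ K) :
    omegaType M (fun _ => 1 / (r : ℝ)) ε m ≤ TG G (r * K) * (m + 1) ^ r := by
  classical
  obtain ⟨S, hcard, htype, hS⟩ := exists_card_eq_omegaType M (fun _ => 1 / (r : ℝ)) ε m
  let t : (Fin m → Fin r) → Fin r → ℕ := fun x a => (Finset.univ.filter fun i => x i = a).card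
  have hmaps : ∀ x ∈ S, t x ∈ Fintype.piFinset fun _ : Fin r => Finset.range (m + 1) := by
    intro x _
    simp only [Fintype.mem_piFinset, Finset.mem_range]
    intro a
    exact Nat.lt_succ_of_le ((Finset.card_le_univ _).trans_eq (by simp))
  have hle := Finset.card_le_mul_card_image_of_maps_to hmaps (TG G (r * K)) ?_
  · rw [hcard] at hle
    simpa using hle
  intro b _
  have hbK : ∀ x ∈ S, ∀ a, t x a ≤ K := by
    intro x hx a
    have h := (abs_le.1 (htype x hx a)).2
    have hm' : (0 : ℝ) < m := by exact_mod_cast hm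
    have h' : ((t x a : ℕ) : ℝ) / m ≤ 1 / r + ε := by
      simp only [t]; linarith
    rw [div_le_iff₀ hm'] at h'
    exact_mod_cast (h'.trans_eq (mul_comm _ _)).trans hK
  refine card_le_TG_of_card_fiber_eq hr hG (ι := Fin m ⊕ Σ a : Fin r, Fin (K - b a)) K _
    (fun x => Sum.elim x Sigma.fst) ?_ ?_
  · intro x hx a
    obtain ⟨hxS, hxb⟩ := Finset.mem_filter.1 hx
    have hsig : Fintype.card {p : Σ a : Fin r, Fin (K - b a) // p.1 = a} = K - b a := by
      rw [Fintype.card_congr (Equiv.sigmaSubtype (β := fun a : Fin r => Fin (K - b a)) a)]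
      simp
    have hsum : (Finset.univ.filter fun i : Fin m ⊕ Σ a : Fin r, Fin (K - b a) =>
        Sum.elim x Sigma.fst i = a).card = t x a + (K - b a) := by
      rw [← hsig, ← Fintype.card_subtype, Fintype.card_congr Equiv.subtypeSum, Fintype.card_sum,
        Fintype.card_subtype]
      rfl
    have h1 := hbK x hxS a
    have h2 : t x a = b a := congrFun hxb a
    omega
  · intro x hx y hy hne
    obtain ⟨i, hi⟩ := hS x (Finset.mem_filter.1 hx).1 y (Finset.mem_filter.1 hy).1 hne
    exact ⟨Sum.inl i, hi⟩

theorem TG_mul_TG_le {r : ℕ} (hr : 0 < r) {M : SimpleGraph (Fin r)} {G : SimpleGraph ℕ}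
    (hG : ∀ a b : ℕ, G.Adj a b ↔
      M.Adj ⟨a % r, Nat.mod_lt a hr⟩ ⟨b % r, Nat.mod_lt b hr⟩)
    {L : ℕ} (hL : r ∣ L) (n : ℕ) :
    TG G L * TG G n ≤ TG G (L + n) := by
  obtain ⟨S, hScard, hS⟩ := exists_card_eq_TG G L
  obtain ⟨T, hTcard, hT⟩ := exists_card_eq_TG G n
  rw [← hScard, ← hTcard, ← Finset.card_product]
  refine card_le_TG G (L + n) (S ×ˢ T)
    (fun p => finSumFinEquiv.permCongr (Equiv.sumCongr p.1 p.2)) ?_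
  rintro ⟨π, σ⟩ h ⟨π', σ'⟩ h' hne
  obtain ⟨hπ, hσ⟩ := Finset.mem_product.1 h
  obtain ⟨hπ', hσ'⟩ := Finset.mem_product.1 h'
  by_cases heq : π = π'
  · have hne' : σ ≠ σ' := fun h => hne (by rw [heq, h])
    obtain ⟨i, hi⟩ := hT σ hσ σ' hσ' hne'
    refine ⟨Fin.natAdd L i, ?_⟩
    rw [hG] at hi ⊢
    obtain ⟨c, rfl⟩ := hL
    simpa [Equiv.permCongr_apply, add_assoc] using hi
  · obtain ⟨i, hi⟩ := hS π hπ π' hπ' heq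
    refine ⟨Fin.castAdd n i, ?_⟩
    simpa [Equiv.permCongr_apply] using hi

theorem TG_pow_le {r : ℕ} (hr : 0 < r) {M : SimpleGraph (Fin r)} {G : SimpleGraph ℕ}
    (hG : ∀ a b : ℕ, G.Adj a b ↔
      M.Adj ⟨a % r, Nat.mod_lt a hr⟩ ⟨b % r, Nat.mod_lt b hr⟩)
    {L : ℕ} (hL : r ∣ L) (q s : ℕ) :
    TG G L ^ q ≤ TG G (L * q + s) := by
  induction q with
  | zero => simpa using one_le_TG G _
  | succ q ih =>
    calc TG G L ^ (q + 1) = TG G L * TG G L ^ q := pow_succ' _ _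
      _ ≤ TG G L * TG G (L * q + s) := Nat.mul_le_mul_left _ ih
      _ ≤ TG G (L + (L * q + s)) := TG_mul_TG_le hr hG hL _
      _ = TG G (L * (q + 1) + s) := by congr 1; ring

/-- `(1/L) log₂ T_G(L)` is an asymptotic lower bound whenever `r ∣ L`. -/
theorem eventually_lt_logb_TG_div {r : ℕ} (hr : 0 < r) {M : SimpleGraph (Fin r)}
    {G : SimpleGraph ℕ}
    (hG : ∀ a b : ℕ, G.Adj a b ↔
      M.Adj ⟨a % r, Nat.mod_lt a hr⟩ ⟨b % r, Nat.mod_lt b hr⟩)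
    {L : ℕ} (hL : r ∣ L) (hL0 : 0 < L) {c : ℝ} (hc : c * L < Real.logb 2 (TG G L)) :
    ∀ᶠ n : ℕ in atTop, c < Real.logb 2 (TG G n) / n := by
  set A := Real.logb 2 (TG G L) with hA
  have hA0 : 0 ≤ A := Real.logb_nonneg (by norm_num) (by exact_mod_cast one_le_TG G L)
  have hL' : (0 : ℝ) < L := by exact_mod_cast hL0
  have hlim : Tendsto (fun n : ℕ => (1 - (L : ℝ) / n) * (A / L)) atTop (nhds (A / L)) := by
    have h := ((tendsto_const_div_atTop_nhds_zero_nat (L : ℝ)).const_sub 1).mul_const (A / L)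
    simpa using h
  filter_upwards [hlim.eventually_const_lt ((lt_div_iff₀ hL').2 hc), eventually_gt_atTop 0]
    with n hn hn0
  refine hn.trans_le ?_
  have hn' : (0 : ℝ) < n := by exact_mod_cast hn0
  have hpow := TG_pow_le hr hG hL (n / L) (n % L)
  rw [Nat.div_add_mod] at hpow
  have hlog : ((n / L : ℕ) : ℝ) * A ≤ Real.logb 2 (TG G n) := by
    rw [hA, ← Real.logb_pow]
    have hpos : (0 : ℝ) < (TG G L : ℝ) ^ (n / L) :=
      pow_pos (by exact_mod_cast one_le_TG G L) _
    exact Real.logb_le_logb_of_le (by norm_num) hpos (by exact_mod_cast hpow)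
  have hq : (n : ℝ) - L ≤ (n / L : ℕ) * L := by
    have h1 := Nat.div_add_mod' n L
    have h2 := Nat.mod_lt n hL0
    have h3 : n ≤ n / L * L + L := by omega
    have h4 : (n : ℝ) ≤ (n / L : ℕ) * L + L := by exact_mod_cast h3
    linarith
  rw [le_div_iff₀ hn']
  refine le_trans ?_ hlog
  calc (1 - (L : ℝ) / n) * (A / L) * n = (n - L) * (A / L) := by field_simp
    _ ≤ ((n / L : ℕ) * L) * (A / L) := by gcongr
    _ = (n / L : ℕ) * A := by field_simp

theorem logb_omegaType_div_mem_Icc {r : ℕ} (hr : 0 < r) (M : SimpleGraph (Fin r)) (P : Fin r → ℝ)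
    (ε : ℝ) (n : ℕ) :
    Real.logb 2 (omegaType M P ε n) / n ∈ Set.Icc 0 (Real.logb 2 r) := by
  have hr1 : (1 : ℝ) ≤ r := by exact_mod_cast hr
  have hr0 : 0 ≤ Real.logb 2 r := Real.logb_nonneg (by norm_num) hr1
  rcases Nat.eq_zero_or_pos (omegaType M P ε n) with h0 | hpos
  · simpa [h0] using hr0
  have hpos' : (1 : ℝ) ≤ omegaType M P ε n := by exact_mod_cast hpos
  refine ⟨div_nonneg (Real.logb_nonneg (by norm_num) hpos') n.cast_nonneg, ?_⟩
  refine div_le_of_le_mul₀ n.cast_nonneg hr0 ?_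
  rw [mul_comm, ← Real.logb_pow]
  exact Real.logb_le_logb_of_le (by norm_num) (by linarith)
    (by exact_mod_cast omegaType_le_pow M P ε n)

theorem isBoundedUnder_le_logb_omegaType_div {r : ℕ} (hr : 0 < r) (M : SimpleGraph (Fin r))
    (P : Fin r → ℝ) (ε : ℝ) :
    atTop.IsBoundedUnder (· ≤ ·) fun n : ℕ => Real.logb 2 (omegaType M P ε n : ℝ) / n :=
  isBoundedUnder_of ⟨_, fun n => (logb_omegaType_div_mem_Icc hr M P ε n).2⟩

theorem isCoboundedUnder_le_logb_omegaType_div {r : ℕ} (hr : 0 < r) (M : SimpleGraph (Fin r))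
    (P : Fin r → ℝ) (ε : ℝ) :
    atTop.IsCoboundedUnder (· ≤ ·) fun n : ℕ => Real.logb 2 (omegaType M P ε n : ℝ) / n :=
  IsBoundedUnder.isCoboundedUnder_le
    (isBoundedUnder_of ⟨0, fun n => (logb_omegaType_div_mem_Icc hr M P ε n).1⟩)

theorem capacityWithin_le_limsup {r : ℕ} (hr : 0 < r) (M : SimpleGraph (Fin r))
    (P : Fin r → ℝ) {ε : ℝ} (hε : 0 < ε) :
    capacityWithin M P ≤
      atTop.limsup fun n : ℕ => Real.logb 2 (omegaType M P ε n : ℝ) / n := by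
  refine ciInf_le ⟨0, ?_⟩ (⟨ε, hε⟩ : {e : ℝ // 0 < e})
  rintro _ ⟨δ, rfl⟩
  exact le_limsup_of_frequently_le
    (Frequently.of_forall fun n => (logb_omegaType_div_mem_Icc hr M P δ n).1)
    (isBoundedUnder_le_logb_omegaType_div hr M P δ)

theorem eventually_mul_logb_add_lt (R B : ℝ) {δ : ℝ} (hδ : 0 < δ) :
    ∀ᶠ m : ℕ in atTop, R * Real.logb 2 ((m : ℝ) + 1) + B < δ * m := by
  have hlog : Tendsto (fun m : ℕ => Real.log ((m : ℝ) + 1) / ((m : ℝ) + 1)) atTop (nhds 0) := by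
    have h := Real.isLittleO_log_id_atTop.tendsto_div_nhds_zero.comp
      (tendsto_atTop_add_const_right atTop (1 : ℝ) tendsto_natCast_atTop_atTop)
    exact h
  have hconst : Tendsto (fun m : ℕ => (B + δ) / ((m : ℝ) + 1)) atTop (nhds 0) :=
    (tendsto_atTop_add_const_right atTop (1 : ℝ) tendsto_natCast_atTop_atTop).const_div_atTop _
  have hsum := (hlog.const_mul (R / Real.log 2)).add hconst
  rw [mul_zero, add_zero] at hsum
  filter_upwards [hsum.eventually_lt_const hδ] with m hm
  have hm1 : (0 : ℝ) < (m : ℝ) + 1 := by positivity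
  rw [← mul_div_assoc, ← add_div, div_lt_iff₀ hm1] at hm
  have heq : R / Real.log 2 * Real.log ((m : ℝ) + 1) = R * Real.logb 2 ((m : ℝ) + 1) := by
    rw [Real.logb]; ring
  rw [heq] at hm
  linarith

theorem eventually_lt_of_lt_capacityWithin {r : ℕ} (hr : 0 < r) {M : SimpleGraph (Fin r)}
    {G : SimpleGraph ℕ}
    (hG : ∀ a b : ℕ, G.Adj a b ↔
      M.Adj ⟨a % r, Nat.mod_lt a hr⟩ ⟨b % r, Nat.mod_lt b hr⟩)
    {c : ℝ} (hc0 : 0 ≤ c) (hc : c < capacityWithin M fun _ => 1 / (r : ℝ)) :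
    ∀ᶠ n : ℕ in atTop, c < Real.logb 2 (TG G n) / n := by
  have hr' : (0 : ℝ) < r := by exact_mod_cast hr
  obtain ⟨d, hcd, hd⟩ := exists_between hc
  obtain ⟨ε, hε, hεd⟩ : ∃ ε : ℝ, 0 < ε ∧ c * (1 + r * ε) < d := by
    refine ⟨(d - c) / (2 * r * (c + 1)), div_pos (by linarith) (by positivity), ?_⟩
    have hlt : c / (c + 1) * ((d - c) / 2) < d - c := by
      have h1 : c / (c + 1) ≤ 1 := (div_le_one (by linarith)).2 (by linarith)
      nlinarith
    have heq : c * (1 + r * ((d - c) / (2 * r * (c + 1)))) =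
        c + c / (c + 1) * ((d - c) / 2) := by
      have : c + 1 ≠ 0 := by positivity
      field_simp
    linarith
  have hfreq := frequently_lt_of_lt_limsup
    (isCoboundedUnder_le_logb_omegaType_div hr M (fun _ => 1 / (r : ℝ)) ε)
    (hd.trans_le (capacityWithin_le_limsup hr M _ hε))
  obtain ⟨m, hmω, hmlog, hm0⟩ := (hfreq.and_eventually
    ((eventually_mul_logb_add_lt r (c * r) (sub_pos.2 hεd)).and (eventually_gt_atTop 0))).exists
  have hm' : (0 : ℝ) < m := by exact_mod_cast hm0
  rw [lt_div_iff₀ hm'] at hmω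
  set K := ⌈(m : ℝ) * (1 / r + ε)⌉₊ with hKdef
  have hKle : (m : ℝ) * (1 / r + ε) ≤ K := Nat.le_ceil _
  have hKlt : (K : ℝ) < m * (1 / r + ε) + 1 := Nat.ceil_lt_add_one (by positivity)
  have hK0 : 0 < K := Nat.ceil_pos.2 (by positivity)
  have hω : 0 < omegaType M (fun _ => 1 / (r : ℝ)) ε m := by
    rw [Nat.pos_iff_ne_zero]
    intro h
    rw [h, Nat.cast_zero, Real.logb_zero] at hmω
    nlinarith
  have hlog : Real.logb 2 (omegaType M (fun _ => 1 / (r : ℝ)) ε m) ≤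
      Real.logb 2 (TG G (r * K)) + r * Real.logb 2 ((m : ℝ) + 1) := by
    have hT : (TG G (r * K) : ℝ) ≠ 0 := by
      exact_mod_cast (Nat.pos_iff_ne_zero.1 (one_le_TG G _))
    rw [← Real.logb_pow, ← Real.logb_mul hT (by positivity)]
    exact Real.logb_le_logb_of_le (by norm_num) (by exact_mod_cast hω)
      (by exact_mod_cast omegaType_le_mul_TG hr hG hm0 hKle)
  refine eventually_lt_logb_TG_div hr hG (dvd_mul_right r K) (Nat.mul_pos hr hK0) ?_
  have hlen : ((r * K : ℕ) : ℝ) ≤ m * (1 + r * ε) + r := by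
    push_cast
    calc (r : ℝ) * K ≤ r * (m * (1 / r + ε) + 1) := by gcongr
      _ = m * (1 + r * ε) + r := by field_simp
  have := mul_le_mul_of_nonneg_left hlen hc0
  linarith

/-- For the residue graph `G` of `M` on `ℕ`,
`lim_{n→∞} (1/n) log₂ TG G n` exists and equals `C(M, Q)` where `Q` is the
uniform distribution on `{0,…,r-1}`. -/
theorem TG_tendsto_capacityWithin (r : ℕ) (hr : 0 < r)
    (M : SimpleGraph (Fin r)) (G : SimpleGraph ℕ)
    (hG : ∀ a b : ℕ, G.Adj a b ↔
      M.Adj ⟨a % r, Nat.mod_lt a hr⟩ ⟨b % r, Nat.mod_lt b hr⟩) :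
    Filter.Tendsto (fun n : ℕ => Real.logb 2 (TG G n : ℝ) / n) Filter.atTop
      (nhds (capacityWithin M fun _ => 1 / (r : ℝ))) := by
  refine tendsto_order.2 ⟨fun c hc => ?_, fun c hc => ?_⟩
  · rcases le_or_gt 0 c with hc0 | hc0
    · exact eventually_lt_of_lt_capacityWithin hr hG hc0 hc
    · refine Eventually.of_forall fun n => hc0.trans_le ?_
      exact div_nonneg (Real.logb_nonneg (by norm_num) (by exact_mod_cast one_le_TG G n))
        n.cast_nonneg
  · have : Nonempty {e : ℝ // 0 < e} := ⟨⟨1, one_pos⟩⟩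
    obtain ⟨⟨ε, hε⟩, hεc⟩ := exists_lt_of_ciInf_lt hc
    have hinv : ∀ᶠ n : ℕ in atTop, 1 / (n : ℝ) < ε :=
      (tendsto_const_div_atTop_nhds_zero_nat (1 : ℝ)).eventually_lt_const hε
    filter_upwards [eventually_lt_of_limsup_lt hεc
      (isBoundedUnder_le_logb_omegaType_div hr M _ ε), hinv, eventually_gt_atTop 0]
      with n hn hnε hn0
    refine lt_of_le_of_lt ?_ hn
    gcongr ?_ / _
    exact Real.logb_le_logb_of_le (by norm_num) (by exact_mod_cast one_le_TG G n)
      (by exact_mod_cast TG_le_omegaType hr hG hn0 hnε.le)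
end

section
/- Let r ≥ 1, let M be a finite simple graph on vertex set {0,1,…,r−1}, and let G be the residue graph on ℕ defined by: a and b are adjacent in G if and only if (a mod r) and (b mod r) are adjacent in M. Then limsup_{n→∞} (1/n) log₂ T_G(n) ≤ C(M), the Shannon capacity of M. -/
open Filter

/-- `omegaN M n` is the largest cardinality of a set of pairwise `M`-different
sequences of length `n` over the vertex set of `M`. -/
noncomputable def omegaN {r : ℕ} (M : SimpleGraph (Fin r)) (n : ℕ) : ℕ :=
  sSup {k | ∃ S : Finset (Fin n → Fin r), S.card = k ∧
    ∀ x ∈ S, ∀ y ∈ S, x ≠ y → ∃ i : Fin n, M.Adj (x i) (y i)}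

/-- The Shannon capacity of `M`: `C(M) = limsup_{n→∞} (1/n) log₂ ω(M,n)`. -/
noncomputable def shannonCapacity {r : ℕ} (M : SimpleGraph (Fin r)) : ℝ :=
  Filter.atTop.limsup fun n : ℕ => Real.logb 2 (omegaN M n : ℝ) / n

/-- The cardinalities of `M`-different families of sequences of length `n` are at most `r ^ n`. -/
theorem card_le_pow_of_mem_omegaN {r : ℕ} (M : SimpleGraph (Fin r)) (n : ℕ) :
    r ^ n ∈ upperBounds {k | ∃ S : Finset (Fin n → Fin r), S.card = k ∧
      ∀ x ∈ S, ∀ y ∈ S, x ≠ y → ∃ i : Fin n, M.Adj (x i) (y i)} := by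
  rintro k ⟨S, rfl, -⟩
  simpa using S.card_le_univ

theorem omegaN_le_pow {r : ℕ} (M : SimpleGraph (Fin r)) (n : ℕ) : omegaN M n ≤ r ^ n :=
  csSup_le ⟨0, ∅, by simp⟩ (card_le_pow_of_mem_omegaN M n)

/-- Reducing the values of permutations modulo `r` turns `G`-different permutations into
`M`-different sequences. -/
theorem TG_le_omegaN {r : ℕ} (hr : 0 < r) (M : SimpleGraph (Fin r)) (G : SimpleGraph ℕ)
    (hG : ∀ a b : ℕ, G.Adj a b ↔
      M.Adj ⟨a % r, Nat.mod_lt a hr⟩ ⟨b % r, Nat.mod_lt b hr⟩) (n : ℕ) :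
    TG G n ≤ omegaN M n := by
  classical
  refine csSup_le ⟨0, ∅, by simp⟩ ?_
  rintro k ⟨S, rfl, hS⟩
  let f : Equiv.Perm (Fin n) → Fin n → Fin r :=
    fun π i => ⟨((π i : ℕ) + 1) % r, Nat.mod_lt _ hr⟩
  have hadj : ∀ π ∈ S, ∀ σ ∈ S, π ≠ σ → ∃ i, M.Adj (f π i) (f σ i) := fun π hπ σ hσ hne =>
    (hS π hπ σ hσ hne).imp fun i hi => (hG _ _).1 hi
  have hinj : Set.InjOn f S := by
    intro π hπ σ hσ h
    by_contra hne
    obtain ⟨i, hi⟩ := hadj π hπ σ hσ hne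
    exact hi.ne (congrFun h i)
  refine le_csSup ⟨_, card_le_pow_of_mem_omegaN M n⟩
    ⟨S.image f, Finset.card_image_of_injOn hinj, ?_⟩
  intro x hx y hy hne
  obtain ⟨π, hπ, rfl⟩ := Finset.mem_image.1 hx
  obtain ⟨σ, hσ, rfl⟩ := Finset.mem_image.1 hy
  exact hadj π hπ σ hσ fun h => hne (h ▸ rfl)

/-- For the residue graph `G` of `M` on `ℕ`,
`limsup_{n→∞} (1/n) log₂ TG G n ≤ C(M)`. -/
theorem TG_limsup_le_shannonCapacity (r : ℕ) (hr : 0 < r)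
    (M : SimpleGraph (Fin r)) (G : SimpleGraph ℕ)
    (hG : ∀ a b : ℕ, G.Adj a b ↔
      M.Adj ⟨a % r, Nat.mod_lt a hr⟩ ⟨b % r, Nat.mod_lt b hr⟩) :
    (Filter.atTop.limsup fun n : ℕ => Real.logb 2 (TG G n : ℝ) / n) ≤
      shannonCapacity M := by
  have hT : ∀ n, (1 : ℝ) ≤ TG G n := fun n => by exact_mod_cast one_le_TG G n
  have hTω : ∀ n, (TG G n : ℝ) ≤ omegaN M n := fun n => by
    exact_mod_cast TG_le_omegaN hr M G hG n
  refine limsup_le_limsup (Eventually.of_forall fun n => ?_) ?_ ?_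
  · have h := Real.logb_le_logb_of_le one_lt_two (by linarith [hT n]) (hTω n)
    dsimp only
    gcongr
  · refine IsBoundedUnder.isCoboundedUnder_le ⟨0, ?_⟩
    refine eventually_map.2 (Eventually.of_forall fun n => ?_)
    exact div_nonneg (Real.logb_nonneg one_lt_two (hT n)) n.cast_nonneg
  · refine ⟨Real.logb 2 r, eventually_map.2 ?_⟩
    filter_upwards [eventually_gt_atTop 0] with n hn
    have hpow : (omegaN M n : ℝ) ≤ (r : ℝ) ^ n := by exact_mod_cast omegaN_le_pow M n
    have h := Real.logb_le_logb_of_le one_lt_two (by linarith [hT n, hTω n]) hpow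
    rw [Real.logb_pow] at h
    rw [div_le_iff₀ (by exact_mod_cast hn)]
    linarith
end
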